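/- arXiv:2605.02610 — 4 statements merged into one kernel-verified Lean document; each statement's English description precedes it below -/
import Mathlib

section
/- For all integers k > ℓ ≥ 2 there exists an integer t₀ such that for every integer t ≥ t₀ and every integer n with n > (1/4)(t+1)²·C(t-1, ℓ-2) + 2t, there exists an ℓ-graph G on n vertices that satisfies the (t,k)-degree condition, has the minimum number of edges among all ℓ-graphs on n vertices satisfying the (t,k)-degree condition (i.e., G is extremal), and contains an isolated copy of K_{t+1}^ℓ. -/
open Finset

open scoped Classical

/-- `E` is the edge set of an `ℓ`-uniform hypergraph on vertex type `V`:
every edge is an `ℓ`-element set. -/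
def IsLGraph {V : Type*} (ℓ : ℕ) (E : Finset (Finset V)) : Prop :=
  ∀ e ∈ E, e.card = ℓ

/-- `S` is a copy of `K_k^ℓ` in the hypergraph with edge set `E`:
`S` has `k` vertices and every `ℓ`-element subset of `S` is an edge. -/
def IsCopy {V : Type*} (E : Finset (Finset V)) (ℓ k : ℕ) (S : Finset V) : Prop :=
  S.card = k ∧ ∀ e ⊆ S, e.card = ℓ → e ∈ E

/-- The number of copies of `K_k^ℓ` containing the vertex `v`. -/
noncomputable def copiesAt {V : Type*} [Fintype V] (E : Finset (Finset V)) (ℓ k : ℕ)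
    (v : V) : ℕ :=
  ((univ : Finset (Finset V)).filter fun S => v ∈ S ∧ IsCopy E ℓ k S).card

/-- The degree of a vertex: the number of edges containing it. -/
noncomputable def hdeg {V : Type*} (E : Finset (Finset V)) (v : V) : ℕ :=
  (E.filter fun e => v ∈ e).card

/-- The `(t,k)`-degree condition: every vertex is contained in at least
`C(t, k-1)` copies of `K_k^ℓ`. -/
def DegCond {V : Type*} [Fintype V] (E : Finset (Finset V)) (ℓ k t : ℕ) : Prop :=
  ∀ v : V, Nat.choose t (k - 1) ≤ copiesAt E ℓ k v

/-- `E` is extremal: it is an `ℓ`-graph satisfying the `(t,k)`-degree condition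
with the minimum number of edges among all such `ℓ`-graphs on the same vertex set. -/
def IsExtremal {V : Type*} [Fintype V] (E : Finset (Finset V)) (ℓ k t : ℕ) : Prop :=
  IsLGraph ℓ E ∧ DegCond E ℓ k t ∧
    ∀ E' : Finset (Finset V), IsLGraph ℓ E' → DegCond E' ℓ k t → E.card ≤ E'.card

/-- `A` is an isolated copy of `K_{t+1}^ℓ`: it is a copy of `K_{t+1}^ℓ` and
every edge meeting `A` is contained in `A`. -/
def IsIsolatedCopy {V : Type*} [DecidableEq V] (E : Finset (Finset V)) (ℓ t : ℕ)
    (A : Finset V) : Prop :=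
  IsCopy E ℓ (t + 1) A ∧ ∀ e ∈ E, (e ∩ A).Nonempty → e ⊆ A

section Shadow

variable {V : Type*} [DecidableEq V]

theorem hdeg_eq_card_filter (E : Finset (Finset V)) (v : V) :
    hdeg E v = (E.filter fun e => v ∈ e).card := by
  unfold hdeg; congr

theorem hdeg_eq_zero_iff {E : Finset (Finset V)} {v : V} : hdeg E v = 0 ↔ ∀ e ∈ E, v ∉ e := by
  rw [hdeg_eq_card_filter, Finset.card_eq_zero, Finset.filter_eq_empty_iff]

theorem card_memberSubfamily_eq_hdeg (E : Finset (Finset V)) (v : V) :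
    (E.memberSubfamily v).card = hdeg E v := by
  rw [hdeg_eq_card_filter]
  unfold Finset.memberSubfamily
  rw [Finset.card_image_of_injOn]
  · intro a ha b hb hab
    simp only [coe_filter, Set.mem_ofPred_eq] at ha hb
    exact (Finset.erase_injOn' v) ha.2 hb.2 hab

theorem memberSubfamily_uniform {r : ℕ} {E : Finset (Finset V)} (h : IsLGraph (r + 1) E) (v : V) :
    IsLGraph r (E.memberSubfamily v) := by
  intro e he
  rw [Finset.mem_memberSubfamily] at he
  have := h _ he.1
  rw [Finset.card_insert_of_notMem he.2] at this
  omega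

/-- Every member of `F` through `v` yields a member of `L` avoiding `v`. -/
theorem hdeg_add_hdeg_le_card {L F : Finset (Finset V)}
    (hLF : ∀ S ∈ F, ∀ x ∈ S, S.erase x ∈ L) (v : V) : hdeg F v + hdeg L v ≤ L.card := by
  rw [← card_memberSubfamily_eq_hdeg F, ← card_memberSubfamily_eq_hdeg L,
    ← Finset.card_memberSubfamily_add_card_nonMemberSubfamily v L, add_comm]
  gcongr
  intro S hS
  rw [Finset.mem_memberSubfamily] at hS
  rw [Finset.mem_nonMemberSubfamily]
  refine ⟨?_, hS.2⟩
  have := hLF _ hS.1 v (Finset.mem_insert_self _ _)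
  rwa [Finset.erase_insert hS.2] at this

theorem hdeg_eq_zero_of_shadow {r : ℕ} (hr : 1 ≤ r) {L F : Finset (Finset V)}
    (hF : IsLGraph (r + 1) F) (hLF : ∀ S ∈ F, ∀ x ∈ S, S.erase x ∈ L) {v : V}
    (h : hdeg L v = 0) : hdeg F v = 0 := by
  rw [hdeg_eq_zero_iff] at h ⊢
  intro S hS hv
  obtain ⟨x, hx, hxv⟩ := Finset.exists_mem_ne (by have := hF S hS; omega : 1 < S.card) v
  exact h _ (hLF S hS x hx) (Finset.mem_erase.2 ⟨hxv.symm, hv⟩)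

variable [Fintype V]

theorem sum_hdeg_of_uniform {r : ℕ} {E : Finset (Finset V)} (h : IsLGraph r E) :
    ∑ v, hdeg E v = r * E.card := by
  have hd := Finset.sum_card_bipartiteAbove_eq_sum_card_bipartiteBelow
    (s := (univ : Finset V)) (t := E) (fun v e => v ∈ e)
  simp only [Finset.bipartiteAbove, Finset.bipartiteBelow] at hd
  calc ∑ v, hdeg E v = ∑ v, (E.filter fun e => v ∈ e).card := by
        exact Finset.sum_congr rfl fun v _ => hdeg_eq_card_filter E v
    _ = _ := hd
    _ = ∑ e ∈ E, r := by
        refine Finset.sum_congr rfl fun e he => ?_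
        rw [← h e he]
        congr 1; ext v; simp
    _ = r * E.card := by rw [Finset.sum_const, smul_eq_mul, mul_comm]

/-- The inductive step of `shadow_bound`: it suffices to control vertices of small degree. -/
theorem shadow_bound_of_local {r t : ℕ} (hr : 1 ≤ r) {L F : Finset (Finset V)}
    (hL : IsLGraph r L) (hF : IsLGraph (r + 1) F) (hLF : ∀ S ∈ F, ∀ x ∈ S, S.erase x ∈ L)
    (hc : L.card ≤ t.choose r)
    (hloc : ∀ v, hdeg L v < (t - 1).choose (r - 1) →
      r * hdeg F v + r * hdeg L v ≤ t * hdeg L v ∧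
        (r * hdeg F v + r * hdeg L v = t * hdeg L v → hdeg L v = 0)) :
    (r + 1) * F.card + r * L.card ≤ t * L.card ∧
      ((r + 1) * F.card + r * L.card = t * L.card → L.Nonempty →
        ∃ U : Finset V, U.card = t ∧ L = U.powersetCard r) := by
  obtain rfl | ht := Nat.eq_zero_or_pos t
  · rw [Nat.choose_eq_zero_of_lt hr, Nat.le_zero, Finset.card_eq_zero] at hc
    subst hc
    have hF0 : F = ∅ := by
      refine Finset.eq_empty_of_forall_notMem fun S hS => ?_
      obtain ⟨x, hx⟩ := Finset.card_pos.1 (by have := hF S hS; omega : 0 < S.card)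
      simpa using hLF S hS x hx
    simp [hF0]
  have hch : r * t.choose r = t * (t - 1).choose (r - 1) := by
    obtain ⟨r, rfl⟩ := Nat.exists_eq_add_of_le' hr
    obtain ⟨t, rfl⟩ := Nat.exists_eq_add_of_le' ht
    simpa [mul_comm] using (Nat.add_one_mul_choose_eq t r).symm
  have hv : ∀ v, r * hdeg F v + r * hdeg L v ≤ t * hdeg L v := by
    intro v
    by_cases hd : hdeg L v < (t - 1).choose (r - 1)
    · exact (hloc v hd).1
    · have h1 := hdeg_add_hdeg_le_card hLF v
      calc r * hdeg F v + r * hdeg L v = r * (hdeg F v + hdeg L v) := by ring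
        _ ≤ r * t.choose r := by gcongr; omega
        _ = t * (t - 1).choose (r - 1) := hch
        _ ≤ t * hdeg L v := by gcongr; omega
  have hveq : ∀ v, r * hdeg F v + r * hdeg L v = t * hdeg L v → hdeg L v ≠ 0 →
      hdeg L v = (t - 1).choose (r - 1) ∧ L.card = t.choose r := by
    intro v hv h0
    by_cases hd : hdeg L v < (t - 1).choose (r - 1)
    · exact absurd ((hloc v hd).2 hv) h0
    · have h1 := hdeg_add_hdeg_le_card hLF v
      push Not at hd
      have h2 : t * (t - 1).choose (r - 1) ≤ t * hdeg L v := by gcongr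
      have h3 : r * (hdeg F v + hdeg L v) ≤ r * t.choose r := by gcongr; omega
      have h5 : t * hdeg L v ≤ t * (t - 1).choose (r - 1) := by rw [← hch]; linarith
      have h6 := Nat.le_of_mul_le_mul_left h5 ht
      refine ⟨le_antisymm h6 hd, le_antisymm hc (le_trans ?_ h1)⟩
      refine Nat.le_of_mul_le_mul_left (?_ : r * _ ≤ r * _) hr
      linarith
  have hsF := sum_hdeg_of_uniform hF
  have hsL := sum_hdeg_of_uniform hL
  have hS1 : ∑ v, (r * hdeg F v + r * hdeg L v) = r * ((r + 1) * F.card + r * L.card) := by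
    rw [Finset.sum_add_distrib, ← Finset.mul_sum, ← Finset.mul_sum, hsF, hsL]; ring
  have hS2 : ∑ v, t * hdeg L v = r * (t * L.card) := by
    rw [← Finset.mul_sum, hsL]; ring
  constructor
  · refine Nat.le_of_mul_le_mul_left (?_ : r * _ ≤ r * _) hr
    rw [← hS1, ← hS2]
    exact Finset.sum_le_sum fun v _ => hv v
  · intro heq hne
    have hall := (Finset.sum_eq_sum_iff_of_le fun v _ => hv v).1 (by rw [hS1, hS2, heq])
    obtain ⟨e, he⟩ := hne
    obtain ⟨x, hx⟩ := Finset.card_pos.1 (by have := hL e he; omega : 0 < e.card)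
    have hpos : ∀ {e : Finset V} {x : V}, e ∈ L → x ∈ e → hdeg L x ≠ 0 := fun {e x} he hx =>
      fun h => hdeg_eq_zero_iff.1 h _ he hx
    have hx0 := hpos he hx
    obtain ⟨hdx, hcL⟩ := hveq x (hall x (mem_univ x)) hx0
    set U : Finset V := univ.filter fun v => hdeg L v ≠ 0
    have hU : U.card = t := by
      have h1 : ∑ v, hdeg L v = U.card * (t - 1).choose (r - 1) := by
        rw [← smul_eq_mul, ← Finset.sum_const, Finset.sum_filter]
        refine Finset.sum_congr rfl fun v _ => ?_
        split_ifs with h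
        · exact (hveq v (hall v (mem_univ v)) h).1
        · exact not_not.1 h
      rw [hsL, hcL, hch] at h1
      exact (Nat.eq_of_mul_eq_mul_right (by omega) h1).symm
    refine ⟨U, hU, Finset.eq_of_subset_of_card_le ?_ ?_⟩
    · intro e he
      refine Finset.mem_powersetCard.2 ⟨fun y hy => ?_, hL e he⟩
      exact Finset.mem_filter.2 ⟨mem_univ _, hpos he hy⟩
    · rw [Finset.card_powersetCard, hU, hcL]

/-- The Kruskal-Katona bound in multiplicative form: an `r`-uniform family of at most `C(t, r)` sets
spans at most `(t - r) / (r + 1)` times as many complete `(r + 1)`-sets, and equality forces the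
family to be complete on a set of size `t`. -/
theorem shadow_bound {r : ℕ} (hr : 1 ≤ r) : ∀ {t : ℕ} {L F : Finset (Finset V)},
    IsLGraph r L → IsLGraph (r + 1) F → (∀ S ∈ F, ∀ x ∈ S, S.erase x ∈ L) →
    L.card ≤ t.choose r →
    (r + 1) * F.card + r * L.card ≤ t * L.card ∧
      ((r + 1) * F.card + r * L.card = t * L.card → L.Nonempty →
        ∃ U : Finset V, U.card = t ∧ L = U.powersetCard r) := by
  induction r, hr using Nat.le_induction with
  | base =>
    intro t L F hL hF hLF hc
    refine shadow_bound_of_local le_rfl hL hF hLF hc fun v hv => ?_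
    have h0 : hdeg L v = 0 := by simpa using hv
    simp [h0, hdeg_eq_zero_of_shadow le_rfl hF hLF h0]
  | succ r hr ih =>
    intro t L F hL hF hLF hc
    refine shadow_bound_of_local (by omega) hL hF hLF hc fun v hv => ?_
    obtain rfl | ht := Nat.eq_zero_or_pos t
    · have h0 : hdeg L v = 0 := by
        rw [zero_tsub, Nat.choose_eq_zero_of_lt (by omega)] at hv; omega
      simp [h0, hdeg_eq_zero_of_shadow (by omega) hF hLF h0]
    obtain ⟨t, rfl⟩ := Nat.exists_eq_add_of_le' ht
    simp only [Nat.add_sub_cancel] at hv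
    have hlink := ih (t := t) (memberSubfamily_uniform hL v) (memberSubfamily_uniform hF v)
      (fun S hS x hx => by
        rw [Finset.mem_memberSubfamily] at hS ⊢
        have hxv : x ≠ v := fun h => hS.2 (h ▸ hx)
        refine ⟨?_, fun h => hS.2 (Finset.mem_of_mem_erase h)⟩
        rw [← Finset.erase_insert_of_ne hxv.symm]
        exact hLF _ hS.1 x (Finset.mem_insert_of_mem hx))
      (by rw [card_memberSubfamily_eq_hdeg]; exact hv.le)
    rw [card_memberSubfamily_eq_hdeg, card_memberSubfamily_eq_hdeg] at hlink
    refine ⟨by linarith [hlink.1], fun heq => ?_⟩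
    by_contra h0
    obtain ⟨U, hU, hLU⟩ := hlink.2 (by linarith) (Finset.card_pos.1 (by
      rw [card_memberSubfamily_eq_hdeg]; omega))
    have := congrArg Finset.card hLU
    rw [card_memberSubfamily_eq_hdeg, Finset.card_powersetCard, hU] at this
    omega

end Shadow

section Degree

variable {V : Type*}

/-- The vertices of `A` all of whose edges lie inside `A`. -/
noncomputable def core (E : Finset (Finset V)) (A : Finset V) : Finset V :=
  A.filter fun v => ∀ e ∈ E, v ∈ e → e ⊆ A

theorem mem_core {E : Finset (Finset V)} {A : Finset V} {v : V} :
    v ∈ core E A ↔ v ∈ A ∧ ∀ e ∈ E, v ∈ e → e ⊆ A := by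
  simp [core]

variable [DecidableEq V] [Fintype V]

/-- The `j`-sets which form a complete `(j + 1)`-set together with `v`. -/
noncomputable def cliqueLinks (E : Finset (Finset V)) (ℓ j : ℕ) (v : V) : Finset (Finset V) :=
  univ.filter fun P => P.card = j ∧ v ∉ P ∧ IsCopy E ℓ (j + 1) (insert v P)

theorem mem_cliqueLinks {E : Finset (Finset V)} {ℓ j : ℕ} {v : V} {P : Finset V} :
    P ∈ cliqueLinks E ℓ j v ↔ P.card = j ∧ v ∉ P ∧ IsCopy E ℓ (j + 1) (insert v P) := by
  simp [cliqueLinks]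

theorem copiesAt_eq_card_cliqueLinks (E : Finset (Finset V)) (ℓ j : ℕ) (v : V) :
    copiesAt E ℓ (j + 1) v = (cliqueLinks E ℓ j v).card := by
  unfold copiesAt
  refine Finset.card_nbij' (fun S => S.erase v) (fun P => insert v P) ?_ ?_ ?_ ?_
  · intro S hS
    simp only [coe_filter, mem_univ, true_and, Set.mem_ofPred_eq] at hS
    rw [mem_coe, mem_cliqueLinks, Finset.insert_erase hS.1, Finset.card_erase_of_mem hS.1, hS.2.1]
    exact ⟨rfl, Finset.notMem_erase _ _, hS.2⟩
  · intro P hP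
    rw [mem_coe, mem_cliqueLinks] at hP
    simpa using hP.2.2
  · intro S hS
    simp only [coe_filter, mem_univ, true_and, Set.mem_ofPred_eq] at hS
    exact Finset.insert_erase hS.1
  · intro P hP
    rw [mem_coe, mem_cliqueLinks] at hP
    exact Finset.erase_insert hP.2.1

theorem cliqueLinks_uniform (E : Finset (Finset V)) (ℓ j : ℕ) (v : V) :
    IsLGraph j (cliqueLinks E ℓ j v) := fun _ hP => (mem_cliqueLinks.1 hP).1

theorem erase_mem_cliqueLinks {E : Finset (Finset V)} {ℓ j : ℕ} {v : V} {S : Finset V}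
    (hS : S ∈ cliqueLinks E ℓ (j + 1) v) {x : V} (hx : x ∈ S) :
    S.erase x ∈ cliqueLinks E ℓ j v := by
  rw [mem_cliqueLinks] at hS ⊢
  have hv : v ∉ S.erase x := fun h => hS.2.1 (Finset.mem_of_mem_erase h)
  have hc : (S.erase x).card = j := by rw [Finset.card_erase_of_mem hx, hS.1]; rfl
  refine ⟨hc, hv, by rw [Finset.card_insert_of_notMem hv, hc], fun e he hcard => ?_⟩
  exact hS.2.2.2 e (he.trans (Finset.insert_subset_insert _ (Finset.erase_subset _ _))) hcard

theorem cliqueLinks_eq_memberSubfamily {r : ℕ} {E : Finset (Finset V)} (hE : IsLGraph (r + 1) E)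
    (v : V) : cliqueLinks E (r + 1) r v = E.memberSubfamily v := by
  ext P
  rw [mem_cliqueLinks, Finset.mem_memberSubfamily]
  constructor
  · rintro ⟨_, hv, hcop⟩
    exact ⟨hcop.2 _ subset_rfl hcop.1, hv⟩
  · rintro ⟨hP, hv⟩
    have hc := hE _ hP
    refine ⟨by rw [Finset.card_insert_of_notMem hv] at hc; omega, hv, hc, fun e he hce => ?_⟩
    rwa [Finset.eq_of_subset_of_card_le he (by omega)]

theorem card_cliqueLinks_succ {E : Finset (Finset V)} {ℓ j t : ℕ} {v : V} (hj : 1 ≤ j) (hjt : j < t)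
    (h : (cliqueLinks E ℓ j v).card ≤ t.choose j) :
    (cliqueLinks E ℓ (j + 1) v).card ≤ t.choose (j + 1) ∧
      ((cliqueLinks E ℓ (j + 1) v).card = t.choose (j + 1) →
        (cliqueLinks E ℓ j v).card = t.choose j ∧
          ∃ U : Finset V, U.card = t ∧ cliqueLinks E ℓ j v = U.powersetCard j) := by
  obtain ⟨h1, h2⟩ := shadow_bound hj (cliqueLinks_uniform E ℓ j v)
    (cliqueLinks_uniform E ℓ (j + 1) v) (fun S hS x hx => erase_mem_cliqueLinks hS hx) h
  set a := (cliqueLinks E ℓ j v).card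
  set b := (cliqueLinks E ℓ (j + 1) v).card
  have hch := Nat.choose_succ_right_eq t j
  obtain ⟨d, rfl⟩ := Nat.exists_eq_add_of_lt hjt
  have hd : j + d + 1 - j = d + 1 := by omega
  rw [hd] at hch
  have h3 : (j + 1) * b ≤ (d + 1) * a := by nlinarith
  have h4 : (d + 1) * a ≤ (d + 1) * (j + d + 1).choose j := by gcongr
  have h5 : 0 < (j + d + 1).choose j := Nat.choose_pos (by omega)
  refine ⟨Nat.le_of_mul_le_mul_left (?_ : (j + 1) * _ ≤ (j + 1) * _) (by omega), fun heq => ?_⟩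
  · linarith
  · rw [heq] at h3 h2
    have h6 : a = (j + d + 1).choose j := by
      refine le_antisymm h (Nat.le_of_mul_le_mul_left (?_ : (d + 1) * _ ≤ (d + 1) * _) (by omega))
      linarith
    refine ⟨h6, h2 (by rw [h6]; nlinarith) (Finset.card_pos.1 ?_)⟩
    change 0 < a
    omega

theorem card_cliqueLinks_lt {E : Finset (Finset V)} {ℓ j t : ℕ} {v : V} (hj : 1 ≤ j)
    (h : (cliqueLinks E ℓ j v).card < t.choose j) {m : ℕ} (hm : j ≤ m) (hmt : m ≤ t) :
    (cliqueLinks E ℓ m v).card < t.choose m := by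
  induction m, hm using Nat.le_induction with
  | base => exact h
  | succ m hm ih =>
    have h1 := ih (by omega)
    obtain ⟨h2, h3⟩ := card_cliqueLinks_succ (hj.trans hm) (by omega) h1.le
    exact lt_of_le_of_ne h2 fun h4 => h1.ne (h3 h4).1

theorem choose_le_hdeg {E : Finset (Finset V)} {r m t : ℕ} (hE : IsLGraph (r + 1) E) (hr : 1 ≤ r)
    (hrm : r < m) (hmt : m ≤ t) {v : V} (h : t.choose m ≤ copiesAt E (r + 1) (m + 1) v) :
    t.choose r ≤ hdeg E v ∧
      (hdeg E v = t.choose r → ∃ A : Finset V, IsCopy E (r + 1) (t + 1) A ∧ v ∈ core E A) := by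
  rw [copiesAt_eq_card_cliqueLinks] at h
  rw [← card_memberSubfamily_eq_hdeg, ← cliqueLinks_eq_memberSubfamily hE]
  refine ⟨?_, fun heq => ?_⟩
  · by_contra! hlt
    exact absurd (card_cliqueLinks_lt hr hlt hrm.le hmt) (by omega)
  · obtain ⟨h2, h3⟩ := card_cliqueLinks_succ hr (by omega) heq.le
    have h4 : (cliqueLinks E (r + 1) (r + 1) v).card = t.choose (r + 1) := by
      by_contra hne
      exact absurd (card_cliqueLinks_lt (by omega) (lt_of_le_of_ne h2 hne) hrm hmt) (by omega)
    obtain ⟨-, U, hU, hLU⟩ := h3 h4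
    have hmem : ∀ {P : Finset V}, P ⊆ U → P.card = r → insert v P ∈ E ∧ v ∉ P := by
      intro P hP hc
      have : P ∈ cliqueLinks E (r + 1) r v := by
        rw [hLU]; exact Finset.mem_powersetCard.2 ⟨hP, hc⟩
      rwa [cliqueLinks_eq_memberSubfamily hE, Finset.mem_memberSubfamily] at this
    have hvU : v ∉ U := by
      intro hv
      obtain ⟨P, hvP, hP, hc⟩ := Finset.exists_subsuperset_card_eq
        (Finset.singleton_subset_iff.2 hv) (by simpa using hr) (by omega : r ≤ U.card)
      exact (hmem hP hc).2 (hvP (Finset.mem_singleton_self v))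
    have hFU : cliqueLinks E (r + 1) m v ⊆ U.powersetCard m := by
      intro P hP
      rw [mem_cliqueLinks] at hP
      refine Finset.mem_powersetCard.2 ⟨fun x hx => ?_, hP.1⟩
      obtain ⟨Q, hxQ, hQ, hc⟩ := Finset.exists_subsuperset_card_eq
        (Finset.singleton_subset_iff.2 hx) (by simpa using hr) (by omega : r ≤ P.card)
      have hvQ : v ∉ Q := fun h => hP.2.1 (hQ h)
      have : Q ∈ cliqueLinks E (r + 1) r v := by
        rw [cliqueLinks_eq_memberSubfamily hE, Finset.mem_memberSubfamily]
        exact ⟨hP.2.2.2 _ (Finset.insert_subset_insert _ hQ)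
          (by rw [Finset.card_insert_of_notMem hvQ, hc]), hvQ⟩
      rw [hLU, Finset.mem_powersetCard] at this
      exact this.1 (hxQ (Finset.mem_singleton_self x))
    have hFU' : cliqueLinks E (r + 1) m v = U.powersetCard m :=
      Finset.eq_of_subset_of_card_le hFU (by rw [Finset.card_powersetCard, hU]; exact h)
    refine ⟨insert v U, ⟨by rw [Finset.card_insert_of_notMem hvU, hU], fun e he hc => ?_⟩,
      mem_core.2 ⟨Finset.mem_insert_self _ _, fun e he hv => ?_⟩⟩
    · by_cases hv : v ∈ e
      · have h5 : e.erase v ⊆ U := Finset.subset_insert_iff.1 he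
        have h6 := (hmem h5 (by rw [Finset.card_erase_of_mem hv, hc]; rfl)).1
        rwa [Finset.insert_erase hv] at h6
      · have h5 : e ⊆ U := (Finset.subset_insert_iff_of_notMem hv).1 he
        obtain ⟨P, heP, hP, hcP⟩ := Finset.exists_subsuperset_card_eq h5
          (by omega : e.card ≤ m) (by omega : m ≤ U.card)
        have h6 : P ∈ cliqueLinks E (r + 1) m v := by
          rw [hFU']; exact Finset.mem_powersetCard.2 ⟨hP, hcP⟩
        exact (mem_cliqueLinks.1 h6).2.2.2 e (heP.trans (Finset.subset_insert _ _)) hc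
    · have h5 : e.erase v ∈ cliqueLinks E (r + 1) r v := by
        rw [cliqueLinks_eq_memberSubfamily hE, Finset.mem_memberSubfamily, Finset.insert_erase hv]
        exact ⟨he, Finset.notMem_erase _ _⟩
      rw [hLU, Finset.mem_powersetCard] at h5
      exact Finset.subset_insert_iff.2 h5.1

theorem choose_le_copiesAt_of_isCopy {E : Finset (Finset V)} {ℓ m t : ℕ} {A : Finset V}
    (hA : IsCopy E ℓ (t + 1) A) {v : V} (hv : v ∈ A) : t.choose m ≤ copiesAt E ℓ (m + 1) v := by
  rw [copiesAt_eq_card_cliqueLinks]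
  have : (A.erase v).card = t := by rw [Finset.card_erase_of_mem hv, hA.1]; rfl
  rw [← this, ← Finset.card_powersetCard]
  refine Finset.card_le_card fun P hP => ?_
  rw [Finset.mem_powersetCard] at hP
  have hvP : v ∉ P := fun h => Finset.notMem_erase v A (hP.1 h)
  rw [mem_cliqueLinks]
  refine ⟨hP.2, hvP, by rw [Finset.card_insert_of_notMem hvP, hP.2], fun e he hc => hA.2 e ?_ hc⟩
  exact he.trans (Finset.insert_subset hv (hP.1.trans (Finset.erase_subset _ _)))

omit [DecidableEq V] in
theorem copiesAt_mono_of {E E' : Finset (Finset V)} {ℓ k : ℕ} {v : V}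
    (h : ∀ S, v ∈ S → IsCopy E ℓ k S → IsCopy E' ℓ k S) :
    copiesAt E ℓ k v ≤ copiesAt E' ℓ k v := by
  unfold copiesAt
  refine Finset.card_le_card fun S hS => ?_
  simp only [mem_filter, mem_univ, true_and] at hS ⊢
  exact ⟨hS.1, h S hS.1 hS.2⟩

end Degree

section Construction

theorem choose_le_choose_add_mul {a t : ℕ} (h : a ≤ t) (r : ℕ) :
    t.choose (r + 1) ≤ a.choose (r + 1) + (t - a) * (t - 1).choose r := by
  induction t, h using Nat.le_induction with
  | base => simp
  | succ t h ih =>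
    rw [Nat.choose_succ_succ, Nat.succ_sub h, Nat.succ_mul, Nat.add_sub_cancel,
      Nat.succ_eq_add_one]
    have h1 : (t - 1).choose r ≤ t.choose r := Nat.choose_le_choose r (Nat.sub_le t 1)
    have h2 : (t - a) * (t - 1).choose r ≤ (t - a) * t.choose r := by gcongr
    omega

theorem overlap_bound {r s t : ℕ} (hs : 1 ≤ s) (hst : s ≤ t + 1) :
    4 * (s * t.choose (r + 1)) ≤
      4 * (s * (s - 1).choose (r + 1)) + (t + 1) ^ 2 * (t - 1).choose r := by
  obtain ⟨a, rfl⟩ := Nat.exists_eq_add_of_le' hs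
  obtain ⟨d, rfl⟩ := Nat.exists_eq_add_of_le (by omega : a ≤ t)
  have h1 := choose_le_choose_add_mul (Nat.le_add_right a d) r
  rw [Nat.add_sub_cancel_left] at h1
  rw [Nat.add_sub_cancel]
  set c := (a + d - 1).choose r
  have h2 : 4 * ((a + 1) * d) ≤ (a + d + 1) ^ 2 := by
    zify
    nlinarith [sq_nonneg ((a : ℤ) + 1 - d)]
  calc 4 * ((a + 1) * (a + d).choose (r + 1))
      ≤ 4 * ((a + 1) * (a.choose (r + 1) + d * c)) := by gcongr
    _ = 4 * ((a + 1) * a.choose (r + 1)) + 4 * ((a + 1) * d) * c := by ring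
    _ ≤ _ := by gcongr

variable {V : Type*} [DecidableEq V]

omit [DecidableEq V] in
theorem IsCopy.mono {E E' : Finset (Finset V)} {ℓ k : ℕ} {A : Finset V} (h : IsCopy E ℓ k A)
    (hE : E ⊆ E') : IsCopy E' ℓ k A :=
  ⟨h.1, fun e he hc => hE (h.2 e he hc)⟩

omit [DecidableEq V] in
theorem isCopy_powersetCard {ℓ k : ℕ} {A : Finset V} (h : A.card = k) :
    IsCopy (A.powersetCard ℓ) ℓ k A :=
  ⟨h, fun _ he hc => Finset.mem_powersetCard.2 ⟨he, hc⟩⟩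

theorem powersetCard_inter' (ℓ : ℕ) (A B : Finset V) :
    A.powersetCard ℓ ∩ B.powersetCard ℓ = (A ∩ B).powersetCard ℓ := by
  ext e
  simp only [mem_inter, mem_powersetCard, Finset.subset_inter_iff]
  tauto

/-- Covering a set by disjoint complete `(t + 1)`-sets, the last two of which may overlap. -/
theorem exists_clique_cover (r t : ℕ) (n : ℕ) : ∀ X : Finset V, X.card = n → t + 1 ≤ n →
    ∃ E : Finset (Finset V), IsLGraph (r + 2) E ∧
      (∀ v ∈ X, ∃ A : Finset V, v ∈ A ∧ IsCopy E (r + 2) (t + 1) A) ∧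
      4 * ((r + 2) * E.card) ≤
        4 * (n * t.choose (r + 1)) + (t + 1) ^ 2 * (t - 1).choose r := by
  have hT : (r + 2) * (t + 1).choose (r + 2) = (t + 1) * t.choose (r + 1) := by
    rw [Nat.add_one_mul_choose_eq, mul_comm]
  induction n using Nat.strong_induction_on with
  | _ n ih =>
    intro X hX hn
    obtain ⟨B, hBX, hB⟩ := Finset.exists_subset_card_eq (by omega : t + 1 ≤ X.card)
    have hXB : (X \ B).card = n - (t + 1) := by rw [Finset.card_sdiff_of_subset hBX, hX, hB]
    by_cases h2 : 2 * (t + 1) ≤ n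
    · obtain ⟨E, hE, hcov, hcard⟩ := ih (n - (t + 1)) (by omega) (X \ B) hXB (by omega)
      refine ⟨E ∪ B.powersetCard (r + 2), ?_, ?_, ?_⟩
      · intro e he
        rcases Finset.mem_union.1 he with he | he
        · exact hE e he
        · exact (Finset.mem_powersetCard.1 he).2
      · intro v hv
        by_cases hvB : v ∈ B
        · exact ⟨B, hvB, (isCopy_powersetCard hB).mono Finset.subset_union_right⟩
        · obtain ⟨A, hvA, hA⟩ := hcov v (Finset.mem_sdiff.2 ⟨hv, hvB⟩)
          exact ⟨A, hvA, hA.mono Finset.subset_union_left⟩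
      · have h3 := Finset.card_union_le E (B.powersetCard (r + 2))
        rw [Finset.card_powersetCard, hB] at h3
        obtain ⟨d, rfl⟩ := Nat.exists_eq_add_of_le' hn
        rw [Nat.add_sub_cancel] at hcard
        have h4 : (r + 2) * (E ∪ B.powersetCard (r + 2)).card ≤
            (r + 2) * (E.card + (t + 1).choose (r + 2)) := by gcongr
        rw [mul_add, hT] at h4
        linarith
    · obtain ⟨B', hXB', hB'X, hB'⟩ := Finset.exists_subsuperset_card_eq
        (Finset.sdiff_subset : X \ B ⊆ X) (by omega : (X \ B).card ≤ t + 1) (by omega)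
      have hun : B ∪ B' = X := by
        refine Finset.Subset.antisymm (Finset.union_subset hBX hB'X) fun x hx => ?_
        by_cases hxB : x ∈ B
        · exact Finset.mem_union_left _ hxB
        · exact Finset.mem_union_right _ (hXB' (Finset.mem_sdiff.2 ⟨hx, hxB⟩))
      have hs := Finset.card_union_add_card_inter B B'
      rw [hun, hX, hB, hB'] at hs
      set s := (B ∩ B').card with hsdef
      refine ⟨B.powersetCard (r + 2) ∪ B'.powersetCard (r + 2), ?_, ?_, ?_⟩
      · intro e he
        rcases Finset.mem_union.1 he with he | he <;> exact (Finset.mem_powersetCard.1 he).2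
      · intro v hv
        rw [← hun, Finset.mem_union] at hv
        rcases hv with hv | hv
        · exact ⟨B, hv, (isCopy_powersetCard hB).mono Finset.subset_union_left⟩
        · exact ⟨B', hv, (isCopy_powersetCard hB').mono Finset.subset_union_right⟩
      · have h3 := Finset.card_union_add_card_inter (B.powersetCard (r + 2))
          (B'.powersetCard (r + 2))
        rw [powersetCard_inter', Finset.card_powersetCard, Finset.card_powersetCard,
          Finset.card_powersetCard, hB, hB', ← hsdef] at h3
        have h4 := overlap_bound (r := r) (by omega : 1 ≤ s) (by omega : s ≤ t + 1)
        have h5 : (r + 2) * s.choose (r + 2) = s * (s - 1).choose (r + 1) := by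
          obtain ⟨a, ha⟩ := Nat.exists_eq_add_of_le' (by omega : 1 ≤ s)
          rw [ha, Nat.add_sub_cancel, Nat.add_one_mul_choose_eq, mul_comm]
        have h6 := congrArg (fun x => (r + 2) * x) h3
        simp only [mul_add, hT, h5] at h6
        have h7 : n * t.choose (r + 1) + s * t.choose (r + 1) =
            (t + 1) * t.choose (r + 1) + (t + 1) * t.choose (r + 1) := by
          rw [← add_mul, ← add_mul, hs]
        linarith

variable [Fintype V]

theorem exists_degCond_card_le {r t m : ℕ} (hn : t + 1 ≤ Fintype.card V) :
    ∃ E : Finset (Finset V), IsLGraph (r + 2) E ∧ DegCond E (r + 2) (m + 1) t ∧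
      4 * ((r + 2) * E.card) ≤
        4 * (Fintype.card V * t.choose (r + 1)) + (t + 1) ^ 2 * (t - 1).choose r := by
  obtain ⟨E, hE, hcov, hcard⟩ := exists_clique_cover r t (Fintype.card V) (univ : Finset V)
    Finset.card_univ hn
  refine ⟨E, hE, fun v => ?_, hcard⟩
  obtain ⟨A, hvA, hA⟩ := hcov v (mem_univ v)
  exact choose_le_copiesAt_of_isCopy hA hvA

theorem exists_isExtremal {r t m : ℕ} (hn : t + 1 ≤ Fintype.card V) :
    ∃ E : Finset (Finset V), IsExtremal E (r + 2) (m + 1) t := by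
  obtain ⟨E₀, h1, h2, -⟩ := exists_degCond_card_le (V := V) (r := r) (m := m) hn
  obtain ⟨E, hE, hmin⟩ := Finset.exists_min_image
    ((univ : Finset (Finset (Finset V))).filter fun E =>
      IsLGraph (r + 2) E ∧ DegCond E (r + 2) (m + 1) t) Finset.card
    ⟨E₀, by simp [h1, h2]⟩
  simp only [mem_filter, mem_univ, true_and] at hE hmin
  exact ⟨E, hE.1, hE.2, fun E' h h' => hmin E' ⟨h, h'⟩⟩

theorem IsExtremal.sum_hdeg_le {r t m : ℕ} {E : Finset (Finset V)}
    (hE : IsExtremal E (r + 2) (m + 1) t) (hn : t + 1 ≤ Fintype.card V) :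
    4 * ∑ v, hdeg E v ≤
      4 * (Fintype.card V * t.choose (r + 1)) + (t + 1) ^ 2 * (t - 1).choose r := by
  obtain ⟨E₀, h1, h2, h3⟩ := exists_degCond_card_le (V := V) (r := r) (m := m) hn
  have h4 := hE.2.2 E₀ h1 h2
  rw [sum_hdeg_of_uniform hE.1]
  refine le_trans ?_ h3
  gcongr

end Construction

section Anchored

variable {V : Type*} [DecidableEq V]

theorem subset_of_mem_core {E : Finset (Finset V)} {ℓ k : ℕ} {A S : Finset V} {v : V}
    (hℓ : 2 ≤ ℓ) (hℓk : ℓ ≤ k) (hS : IsCopy E ℓ k S) (hv : v ∈ core E A) (hvS : v ∈ S) :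
    S ⊆ A := by
  intro u hu
  have h1 : ({v, u} : Finset V) ⊆ S := by
    intro x hx
    simp only [Finset.mem_insert, Finset.mem_singleton] at hx
    rcases hx with rfl | rfl <;> assumption
  obtain ⟨e, h2, h3, h4⟩ := Finset.exists_subsuperset_card_eq h1
    (Finset.card_le_two.trans hℓ) (by rw [hS.1]; exact hℓk)
  exact (mem_core.1 hv).2 e (hS.2 e h3 h4) (h2 (by simp)) (h2 (by simp))

theorem eq_of_mem_core {E : Finset (Finset V)} {ℓ k : ℕ} {A B : Finset V} {v : V}
    (hℓ : 2 ≤ ℓ) (hℓk : ℓ ≤ k) (hA : IsCopy E ℓ k A) (hB : IsCopy E ℓ k B)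
    (hv : v ∈ core E A) (hvB : v ∈ B) : A = B :=
  (Finset.eq_of_subset_of_card_le (subset_of_mem_core hℓ hℓk hB hv hvB)
    (by rw [hA.1, hB.1])).symm

omit [DecidableEq V] in
theorem core_subset (E : Finset (Finset V)) (A : Finset V) : core E A ⊆ A := fun _ hv =>
  (mem_core.1 hv).1

theorem isIsolatedCopy_of_core_eq {E : Finset (Finset V)} {ℓ t : ℕ} {A : Finset V}
    (hA : IsCopy E ℓ (t + 1) A) (h : core E A = A) : IsIsolatedCopy E ℓ t A := by
  refine ⟨hA, fun e he ⟨v, hv⟩ => ?_⟩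
  rw [Finset.mem_inter, ← h] at hv
  rw [h] at hv
  exact (mem_core.1 (h.symm ▸ hv.2)).2 e he hv.1

theorem hdeg_powersetCard {A : Finset V} {w : V} (hw : w ∈ A) (r : ℕ) :
    hdeg (A.powersetCard (r + 1)) w = (A.card - 1).choose r := by
  rw [← card_memberSubfamily_eq_hdeg, ← Finset.card_erase_of_mem hw, ← Finset.card_powersetCard]
  congr 1
  ext P
  rw [Finset.mem_memberSubfamily, Finset.mem_powersetCard, Finset.mem_powersetCard,
    Finset.subset_erase]
  constructor
  · rintro ⟨⟨h1, h2⟩, h3⟩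
    rw [Finset.card_insert_of_notMem h3] at h2
    exact ⟨⟨(Finset.subset_insert _ _).trans h1, h3⟩, by omega⟩
  · rintro ⟨⟨h1, h2⟩, h3⟩
    rw [Finset.card_insert_of_notMem h2]
    exact ⟨⟨Finset.insert_subset hw h1, by omega⟩, h2⟩

theorem mem_core_of_hdeg_le {E : Finset (Finset V)} {r t : ℕ} {A : Finset V} {w : V}
    (hA : IsCopy E (r + 1) (t + 1) A) (hw : w ∈ A) (h : hdeg E w ≤ t.choose r) :
    w ∈ core E A := by
  have h1 := hdeg_powersetCard hw r
  rw [hA.1, Nat.add_sub_cancel, hdeg_eq_card_filter] at h1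
  rw [hdeg_eq_card_filter, ← h1] at h
  have h2 := Finset.eq_of_subset_of_card_le (by
    intro e he
    rw [Finset.mem_filter, Finset.mem_powersetCard] at he
    exact Finset.mem_filter.2 ⟨hA.2 e he.1.1 he.1.2, he.2⟩) h
  refine mem_core.2 ⟨hw, fun e he hwe => ?_⟩
  have h3 : e ∈ E.filter fun e => w ∈ e := Finset.mem_filter.2 ⟨he, hwe⟩
  rw [← h2, Finset.mem_filter, Finset.mem_powersetCard] at h3
  exact h3.1.1

/-- The edges through `w` which meet the core of `A`. -/
noncomputable def coreEdges (E : Finset (Finset V)) (A : Finset V) (w : V) : Finset (Finset V) :=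
  E.filter fun e => w ∈ e ∧ (e ∩ core E A).Nonempty

theorem mem_coreEdges {E : Finset (Finset V)} {A : Finset V} {w : V} {e : Finset V} :
    e ∈ coreEdges E A w ↔ e ∈ E ∧ w ∈ e ∧ (e ∩ core E A).Nonempty := by
  simp [coreEdges]

theorem choose_add_sum_card_coreEdges_le {E : Finset (Finset V)} {r t : ℕ} (hr : 1 ≤ r)
    (hrt : r ≤ t) {w : V} {I : Finset (Finset V)} {J : Finset V} (hJ : J ∈ I)
    (hI : ∀ A ∈ I, IsCopy E (r + 1) (t + 1) A) (hwJ : w ∈ J) :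
    t.choose r + ∑ A ∈ I.erase J, (coreEdges E A w).card ≤ hdeg E w := by
  have h1 := hdeg_powersetCard hwJ r
  rw [(hI J hJ).1, Nat.add_sub_cancel, hdeg_eq_card_filter] at h1
  have hℓ : 2 ≤ r + 1 := by omega
  have hℓt : r + 1 ≤ t + 1 := by omega
  rw [← h1, hdeg_eq_card_filter, ← Finset.card_biUnion, ← Finset.card_union_of_disjoint]
  · refine Finset.card_le_card fun e he => ?_
    simp only [Finset.mem_union, Finset.mem_filter, Finset.mem_powersetCard, Finset.mem_biUnion,
      mem_coreEdges] at he ⊢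
    rcases he with he | ⟨A, -, he⟩
    · exact ⟨(hI J hJ).2 e he.1.1 he.1.2, he.2⟩
    · exact ⟨he.1, he.2.1⟩
  · rw [Finset.disjoint_left]
    intro e he he'
    simp only [Finset.mem_filter, Finset.mem_powersetCard, Finset.mem_biUnion,
      mem_coreEdges] at he he'
    obtain ⟨A, hA, -, -, u, hu⟩ := he'
    rw [Finset.mem_inter] at hu
    rw [Finset.mem_erase] at hA
    exact hA.1 (eq_of_mem_core hℓ hℓt (hI A hA.2) (hI J hJ) hu.2 (he.1.1 hu.1))
  · intro A hA B hB hAB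
    rw [Function.onFun, Finset.disjoint_left]
    intro e he he'
    rw [mem_coreEdges] at he he'
    obtain ⟨u, hu⟩ := he.2.2
    obtain ⟨u', hu'⟩ := he'.2.2
    rw [Finset.mem_inter] at hu hu'
    have hA' := hI A (Finset.mem_of_mem_erase hA)
    have hB' := hI B (Finset.mem_of_mem_erase hB)
    exact hAB (eq_of_mem_core hℓ hℓt hA' hB' hu.2
      ((mem_core.1 hu'.2).2 e he.1 hu'.1 hu.1))

theorem card_core_le_card_coreEdges {E : Finset (Finset V)} {t : ℕ} {A : Finset V} {w : V}
    (hA : IsCopy E 2 t A) (hw : w ∈ A) (hwc : w ∉ core E A) :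
    (core E A).card ≤ (coreEdges E A w).card := by
  refine Finset.card_le_card_of_injOn (fun u => {w, u}) ?_ ?_
  · intro u hu
    have hu : u ∈ core E A := hu
    have hne : w ≠ u := by rintro rfl; exact hwc hu
    rw [Finset.mem_coe, mem_coreEdges]
    refine ⟨hA.2 _ ?_ (Finset.card_pair hne), by simp, u, by simp [hu]⟩
    intro x hx
    simp only [Finset.mem_insert, Finset.mem_singleton] at hx
    rcases hx with rfl | rfl
    · exact hw
    · exact core_subset _ _ hu
  · intro u hu u' hu' h
    have hu : u ∈ core E A := hu
    have h1 : u ∈ ({w, u'} : Finset V) := by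
      have h2 : ({w, u} : Finset V) = {w, u'} := h
      rw [← h2]; simp
    simp only [Finset.mem_insert, Finset.mem_singleton] at h1
    rcases h1 with rfl | h1
    · exact absurd hu hwc
    · exact h1

theorem choose_le_card_filter_pair {A : Finset V} {u w : V} (hu : u ∈ A) (hw : w ∈ A)
    (huw : w ≠ u) (r : ℕ) :
    (A.card - 2).choose r ≤
      ((A.powersetCard (r + 2)).filter fun e => w ∈ e ∧ u ∈ e).card := by
  have h1 : ((A.erase w).erase u).card = A.card - 2 := by
    rw [Finset.card_erase_of_mem (Finset.mem_erase.2 ⟨huw.symm, hu⟩),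
      Finset.card_erase_of_mem hw]
    omega
  rw [← h1, ← Finset.card_powersetCard]
  refine Finset.card_le_card_of_injOn (fun P => insert w (insert u P)) ?_ ?_
  · intro P hP
    rw [Finset.mem_coe, Finset.mem_powersetCard, Finset.subset_erase, Finset.subset_erase] at hP
    obtain ⟨⟨⟨h2, h3⟩, h4⟩, h5⟩ := hP
    have h6 : w ∉ insert u P := by
      rw [Finset.mem_insert]; tauto
    rw [Finset.mem_coe, Finset.mem_filter, Finset.mem_powersetCard,
      Finset.card_insert_of_notMem h6, Finset.card_insert_of_notMem h4, h5]
    exact ⟨⟨Finset.insert_subset hw (Finset.insert_subset hu h2), rfl⟩, by simp, by simp⟩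
  · intro P hP Q hQ h
    rw [Finset.mem_coe, Finset.mem_powersetCard, Finset.subset_erase, Finset.subset_erase] at hP hQ
    have h : insert w (insert u P) = insert w (insert u Q) := h
    ext x
    have h7 : x ∈ insert w (insert u P) ↔ x ∈ insert w (insert u Q) := by rw [h]
    simp only [Finset.mem_insert] at h7
    by_cases hxw : x = w
    · subst hxw; exact iff_of_false hP.1.1.2 hQ.1.1.2
    by_cases hxu : x = u
    · subst hxu; exact iff_of_false hP.1.2 hQ.1.2
    · tauto

theorem choose_le_card_coreEdges {E : Finset (Finset V)} {r t : ℕ} {A : Finset V} {w : V}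
    (hA : IsCopy E (r + 2) (t + 1) A) (hw : w ∈ A) (hwc : w ∉ core E A)
    (hc : (core E A).Nonempty) : (t - 1).choose r ≤ (coreEdges E A w).card := by
  obtain ⟨u, hu⟩ := hc
  have hne : w ≠ u := by rintro rfl; exact hwc hu
  have h1 := choose_le_card_filter_pair (core_subset _ _ hu) hw hne r
  rw [hA.1] at h1
  refine h1.trans (Finset.card_le_card fun e he => ?_)
  rw [Finset.mem_filter, Finset.mem_powersetCard] at he
  rw [mem_coreEdges]
  exact ⟨hA.2 e he.1.1 he.1.2, he.2.1, u, Finset.mem_inter.2 ⟨he.2.2, hu⟩⟩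

end Anchored

section Swap

variable {V : Type*} [DecidableEq V] [Fintype V]

/-- Two overlapping complete sets can be traded for an isolated one, using a complete set `F`
disjoint from both of them to refill the overlap. -/
theorem exists_isIsolatedCopy_of_swap {E : Finset (Finset V)} {r t m : ℕ} {A B F : Finset V}
    (hr : 1 ≤ r) (hrt : r ≤ t) (hrm : r ≤ m) (hE : IsExtremal E (r + 1) (m + 1) t)
    (hA : IsCopy E (r + 1) (t + 1) A) (hB : IsCopy E (r + 1) (t + 1) B) (hAB : A ≠ B)
    (hc : (A \ core E A).card ≤ (core E B).card) (hFA : Disjoint F A) (hFB : Disjoint F B)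
    (hF : F.card = (A ∩ B).card) (hFE : ∀ e ⊆ F, e.card = r + 1 → e ∈ E) :
    ∃ E' : Finset (Finset V), IsExtremal E' (r + 1) (m + 1) t ∧
      ∃ Z : Finset V, IsIsolatedCopy E' (r + 1) t Z := by
  have hℓ : 2 ≤ r + 1 := by omega
  have hℓt : r + 1 ≤ t + 1 := by omega
  obtain ⟨Y, hYB, hY⟩ := Finset.exists_subset_card_eq hc
  have hcA := core_subset E A
  have hcB := core_subset E B
  have hA1 : ∀ v ∈ core E A, v ∉ B := fun v hv hvB => hAB (eq_of_mem_core hℓ hℓt hA hB hv hvB)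
  have hB1 : ∀ v ∈ core E B, v ∉ A :=
    fun v hv hvA => hAB (eq_of_mem_core hℓ hℓt hB hA hv hvA).symm
  have hdA : (A \ core E A).card + (core E A).card = t + 1 := by
    rw [Finset.card_sdiff_add_card_eq_card hcA, hA.1]
  have hdB : (B \ Y).card + Y.card = t + 1 := by
    rw [Finset.card_sdiff_add_card_eq_card (hYB.trans hcB), hB.1]
  set D := A \ core E A with hD
  set Z := core E A ∪ Y with hZ
  set R := (B \ Y ∪ D) ∪ F with hR
  have hZc : Z.card = t + 1 := by
    rw [hZ, Finset.card_union_of_disjoint]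
    · omega
    · rw [Finset.disjoint_left]
      exact fun v hv hv' => hA1 v hv (hcB (hYB hv'))
  have h_inter : (B \ Y) ∩ D = A ∩ B := by
    ext v
    simp only [hD, Finset.mem_inter, Finset.mem_sdiff]
    constructor
    · tauto
    · rintro ⟨h1, h2⟩
      exact ⟨⟨h2, fun h => hB1 v (hYB h) h1⟩, h1, fun h => hA1 v h h2⟩
  have hdisF : Disjoint (B \ Y ∪ D) F := by
    rw [Finset.disjoint_left] at hFA hFB ⊢
    intro v hv hvF
    simp only [hD, Finset.mem_union, Finset.mem_sdiff] at hv
    rcases hv with hv | hv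
    · exact hFB hvF hv.1
    · exact hFA hvF hv.1
  have hRc : R.card = t + 1 := by
    rw [hR, Finset.card_union_of_disjoint hdisF, hF, ← h_inter, Finset.card_union_add_card_inter]
    omega
  have hZR : ∀ v ∈ Z, v ∉ R := by
    intro v hv
    rw [Finset.disjoint_left] at hFA hFB
    simp only [hZ, hR, hD, Finset.mem_union, Finset.mem_sdiff] at hv ⊢
    rcases hv with hv | hv
    · have := hA1 v hv
      have h2 : v ∉ F := fun h => hFA h (hcA hv)
      tauto
    · have := hB1 v (hYB hv)
      have h2 : v ∉ F := fun h => hFB h (hcB (hYB hv))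
      tauto
  set P : Finset V → Finset (Finset V) := fun X => X.powersetCard (r + 1) with hP
  have hPm : ∀ X e, e ∈ P X ↔ e ⊆ X ∧ e.card = r + 1 := fun X e => Finset.mem_powersetCard
  set E₀ := E.filter fun e => Disjoint e Z with hE₀
  set E₁ := E.filter fun e => ¬ Disjoint e Z with hE₁
  have hsplit : E₀.card + E₁.card = E.card := Finset.card_filter_add_card_filter_not _
  -- the edges which are removed
  have hmiss : ((P A \ P D) ∪ (P B \ P (B \ Y))).card ≤ E₁.card := by
    refine Finset.card_le_card fun e he => ?_
    simp only [Finset.mem_union, Finset.mem_sdiff, hPm] at he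
    rw [hE₁, Finset.mem_filter, Finset.not_disjoint_iff]
    rcases he with ⟨⟨h1, h2⟩, h3⟩ | ⟨⟨h1, h2⟩, h3⟩
    · refine ⟨hA.2 e h1 h2, ?_⟩
      by_contra hcon
      push Not at hcon
      refine h3 ⟨fun v hv => ?_, h2⟩
      rw [hD, Finset.mem_sdiff]
      exact ⟨h1 hv, fun h => hcon v hv (Finset.mem_union_left _ h)⟩
    · refine ⟨hB.2 e h1 h2, ?_⟩
      by_contra hcon
      push Not at hcon
      refine h3 ⟨fun v hv => ?_, h2⟩
      rw [Finset.mem_sdiff]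
      exact ⟨h1 hv, fun h => hcon v hv (Finset.mem_union_right _ h)⟩
  have hdisj : Disjoint (P A \ P D) (P B \ P (B \ Y)) := by
    rw [Finset.disjoint_left]
    intro e he he'
    simp only [Finset.mem_sdiff, hPm] at he he'
    refine he.2 ⟨fun v hv => ?_, he.1.2⟩
    rw [hD, Finset.mem_sdiff]
    exact ⟨he.1.1 hv, fun h => hA1 v h (he'.1.1 hv)⟩
  have hPmono : ∀ {X X'}, X ⊆ X' → P X ⊆ P X' := fun h => Finset.powersetCard_mono h
  have hcPA : (P A \ P D).card + (P D).card = (t + 1).choose (r + 1) := by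
    rw [Finset.card_sdiff_add_card_eq_card (hPmono Finset.sdiff_subset), Finset.card_powersetCard,
      hA.1]
  have hcPB : (P B \ P (B \ Y)).card + (P (B \ Y)).card = (t + 1).choose (r + 1) := by
    rw [Finset.card_sdiff_add_card_eq_card (hPmono Finset.sdiff_subset), Finset.card_powersetCard,
      hB.1]
  rw [Finset.card_union_of_disjoint hdisj] at hmiss
  -- the edges inside `R` which are already there
  have hE₀R : (P (B \ Y) ∪ P D ∪ P F) ⊆ P R ∩ E₀ := by
    intro e he
    have he1 : e ∈ P R := by
      simp only [Finset.mem_union] at he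
      rcases he with (he | he) | he
      · exact hPmono (Finset.subset_union_left.trans Finset.subset_union_left) he
      · exact hPmono (Finset.subset_union_right.trans Finset.subset_union_left) he
      · exact hPmono Finset.subset_union_right he
    rw [Finset.mem_inter, hE₀, Finset.mem_filter]
    refine ⟨he1, ?_, ?_⟩
    · simp only [Finset.mem_union, hPm] at he
      rcases he with (he | he) | he
      · exact hB.2 e (he.1.trans Finset.sdiff_subset) he.2
      · exact hA.2 e (he.1.trans Finset.sdiff_subset) he.2
      · exact hFE e he.1 he.2
    · rw [Finset.disjoint_right]
      exact fun v hv hve => hZR v hv (((hPm _ _).1 he1).1 hve)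
  have hunion : (P (B \ Y) ∪ P D ∪ P F).card = (P (B \ Y)).card + (P D).card := by
    have h1 := Finset.card_union_add_card_inter (P (B \ Y)) (P D)
    rw [powersetCard_inter', h_inter, Finset.card_powersetCard, ← hF,
      ← Finset.card_powersetCard] at h1
    rw [Finset.card_union_of_disjoint, ← h1]
    rw [Finset.disjoint_left]
    intro e he he'
    simp only [Finset.mem_union, hPm] at he he'
    obtain ⟨v, hv⟩ : e.Nonempty := Finset.card_pos.1 (by omega)
    refine Finset.disjoint_left.1 hdisF (Finset.mem_union.2 ?_) (he'.1 hv)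
    rcases he with he | he
    · exact Or.inl (he.1 hv)
    · exact Or.inr (he.1 hv)
  have hnew : (P R \ E₀).card + ((P (B \ Y)).card + (P D).card) ≤ (t + 1).choose (r + 1) := by
    have h1 := Finset.card_sdiff_add_card_inter (P R) E₀
    rw [Finset.card_powersetCard, hRc] at h1
    have h2 := Finset.card_le_card hE₀R
    omega
  set E' := (E₀ ∪ P R) ∪ P Z with hE'
  have hcard : E'.card ≤ E.card := by
    have h1 := Finset.card_union_le (E₀ ∪ P R) (P Z)
    have h2 : (E₀ ∪ P R).card = E₀.card + (P R \ E₀).card := by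
      rw [← Finset.card_union_of_disjoint Finset.disjoint_sdiff, Finset.union_sdiff_self_eq_union]
    have h3 : (P Z).card = (t + 1).choose (r + 1) := by rw [Finset.card_powersetCard, hZc]
    rw [← hE'] at h1
    omega
  have hZcopy : IsCopy E' (r + 1) (t + 1) Z :=
    (isCopy_powersetCard hZc).mono Finset.subset_union_right
  have hRcopy : IsCopy E' (r + 1) (t + 1) R :=
    (isCopy_powersetCard hRc).mono (Finset.subset_union_right.trans Finset.subset_union_left)
  refine ⟨E', ⟨?_, ?_, fun E'' h h' => hcard.trans (hE.2.2 E'' h h')⟩, Z, hZcopy, ?_⟩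
  · intro e he
    simp only [hE', Finset.mem_union, hPm] at he
    rcases he with (he | he) | he
    · exact hE.1 e (Finset.mem_of_mem_filter e he)
    · exact he.2
    · exact he.2
  · intro v
    by_cases hvZ : v ∈ Z
    · exact choose_le_copiesAt_of_isCopy hZcopy hvZ
    by_cases hvR : v ∈ R
    · exact choose_le_copiesAt_of_isCopy hRcopy hvR
    refine (hE.2.1 v).trans (copiesAt_mono_of fun S hvS hS => ⟨hS.1, fun e heS he => ?_⟩)
    refine Finset.mem_union_left _ (Finset.mem_union_left _ (Finset.mem_filter.2
      ⟨hS.2 e heS he, ?_⟩))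
    rw [Finset.disjoint_left]
    intro z hze hzZ
    rcases Finset.mem_union.1 hzZ with hz | hz
    · have hvA := subset_of_mem_core hℓ (by omega) hS hz (heS hze) hvS
      refine hvR (Finset.mem_union_left _ (Finset.mem_union_right _ ?_))
      exact Finset.mem_sdiff.2 ⟨hvA, fun h => hvZ (Finset.mem_union_left _ h)⟩
    · have hvB := subset_of_mem_core hℓ (by omega) hS (hYB hz) (heS hze) hvS
      refine hvR (Finset.mem_union_left _ (Finset.mem_union_left _ ?_))
      exact Finset.mem_sdiff.2 ⟨hvB, fun h => hvZ (Finset.mem_union_right _ h)⟩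
  · rintro e he ⟨v, hv⟩
    rw [Finset.mem_inter] at hv
    simp only [hE', Finset.mem_union, hPm] at he
    rcases he with (he | he) | he
    · exact absurd hv.2 (Finset.disjoint_left.1 (Finset.mem_filter.1 he).2 hv.1)
    · exact absurd (he.1 hv.1) (hZR v hv.2)
    · exact he.1

end Swap

section Accounting

variable {V : Type*} [DecidableEq V] [Fintype V]

/-- The complete `(t + 1)`-sets with nonempty core. -/
noncomputable def anchored (E : Finset (Finset V)) (ℓ t : ℕ) : Finset (Finset V) :=
  univ.filter fun A => IsCopy E ℓ (t + 1) A ∧ (core E A).Nonempty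

omit [DecidableEq V] in
theorem mem_anchored {E : Finset (Finset V)} {ℓ t : ℕ} {A : Finset V} :
    A ∈ anchored E ℓ t ↔ IsCopy E ℓ (t + 1) A ∧ (core E A).Nonempty := by
  simp [anchored]

/-- The vertices outside all cores of members of `𝒜`. -/
noncomputable def outside (E 𝒜 : Finset (Finset V)) : Finset V :=
  univ.filter fun v => ∀ A ∈ 𝒜, v ∉ core E A

theorem mem_outside {E 𝒜 : Finset (Finset V)} {v : V} :
    v ∈ outside E 𝒜 ↔ ∀ A ∈ 𝒜, v ∉ core E A := by
  simp [outside]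

theorem card_outside_add_sum {E 𝒜 : Finset (Finset V)} {ℓ k : ℕ} (hℓ : 2 ≤ ℓ) (hℓk : ℓ ≤ k)
    (h𝒜 : ∀ A ∈ 𝒜, IsCopy E ℓ k A) :
    (outside E 𝒜).card + ∑ A ∈ 𝒜, (core E A).card = Fintype.card V := by
  rw [← Finset.card_biUnion, ← Finset.card_union_of_disjoint, ← Finset.card_univ]
  · congr 1
    ext v
    simp only [Finset.mem_union, mem_outside, Finset.mem_biUnion, mem_univ, iff_true]
    by_contra! h
    obtain ⟨⟨A, hA, hv⟩, h2⟩ := h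
    exact h2 A hA hv
  · rw [Finset.disjoint_left]
    intro v hv hv'
    obtain ⟨A, hA, hvA⟩ := Finset.mem_biUnion.1 hv'
    exact mem_outside.1 hv A hA hvA
  · intro A hA B hB hAB
    rw [Function.onFun, Finset.disjoint_left]
    exact fun v hv hv' => hAB (eq_of_mem_core hℓ hℓk (h𝒜 A hA) (h𝒜 B hB) hv
      (core_subset _ _ hv'))

theorem sum_sdiff_core {E 𝒜 ℬ : Finset (Finset V)} {ℓ k : ℕ} (hℓ : 2 ≤ ℓ) (hℓk : ℓ ≤ k)
    (h𝒜 : ∀ A ∈ 𝒜, IsCopy E ℓ k A) (hℬ : ℬ ⊆ 𝒜) (f : Finset V → ℕ) :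
    ∑ w ∈ outside E 𝒜, ∑ A ∈ ℬ.filter (fun A => w ∈ A), f A =
      ∑ A ∈ ℬ, (A \ core E A).card * f A := by
  simp only [Finset.sum_filter]
  rw [Finset.sum_comm]
  refine Finset.sum_congr rfl fun A hA => ?_
  rw [← Finset.sum_filter, Finset.sum_const, smul_eq_mul]
  congr 2
  ext v
  rw [Finset.mem_filter, Finset.mem_sdiff, mem_outside]
  constructor
  · exact fun ⟨h1, h2⟩ => ⟨h2, h1 A (hℬ hA)⟩
  · rintro ⟨h1, h2⟩
    refine ⟨fun B hB hv => h2 ?_, h1⟩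
    rwa [← eq_of_mem_core hℓ hℓk (h𝒜 B hB) (h𝒜 A (hℬ hA)) hv h1]

theorem sum_card_sdiff_core {E 𝒜 : Finset (Finset V)} {ℓ k : ℕ} (hℓ : 2 ≤ ℓ) (hℓk : ℓ ≤ k)
    (h𝒜 : ∀ A ∈ 𝒜, IsCopy E ℓ k A) :
    ∑ w ∈ outside E 𝒜, (𝒜.filter fun A => w ∈ A).card = ∑ A ∈ 𝒜, (A \ core E A).card := by
  have h := sum_sdiff_core hℓ hℓk h𝒜 subset_rfl fun _ => 1
  simpa only [Finset.sum_const, smul_eq_mul, mul_one] using h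

/-- Summing a lower bound for the degrees of the vertices outside all cores. -/
theorem sum_outside_le {E 𝒜 : Finset (Finset V)} {δ M : ℕ} (f : V → ℕ)
    (hδ : ∀ v, δ ≤ hdeg E v) (hf : ∀ v ∈ outside E 𝒜, δ + f v ≤ hdeg E v)
    (hM : 4 * ∑ v, hdeg E v ≤ 4 * (Fintype.card V * δ) + M) :
    4 * ∑ v ∈ outside E 𝒜, f v ≤ M := by
  have h1 : ∑ v : V, (δ + if v ∈ outside E 𝒜 then f v else 0) ≤ ∑ v, hdeg E v := by
    refine Finset.sum_le_sum fun v _ => ?_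
    split_ifs with h
    · exact hf v h
    · exact hδ v
  rw [Finset.sum_add_distrib, Finset.sum_const, Finset.card_univ, smul_eq_mul,
    Finset.sum_ite_mem, Finset.univ_inter] at h1
  omega

theorem no_three_large {E : Finset (Finset V)} {r t m : ℕ} {A B G : Finset V}
    (hr : 1 ≤ r) (hrt : r ≤ t) (hrm : r ≤ m) (hE : IsExtremal E (r + 1) (m + 1) t)
    (hno : ∀ E' : Finset (Finset V), IsExtremal E' (r + 1) (m + 1) t →
      ∀ Z, ¬ IsIsolatedCopy E' (r + 1) t Z)
    (hA : IsCopy E (r + 1) (t + 1) A) (hB : IsCopy E (r + 1) (t + 1) B)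
    (hG : IsCopy E (r + 1) (t + 1) G) (hAB : A ≠ B) (hAG : A ≠ G) (hBG : B ≠ G)
    (hcA : (A \ core E A).card ≤ (core E A).card) (hcB : (B \ core E B).card ≤ (core E B).card)
    (hcG : (G \ core E G).card ≤ (core E G).card) : False := by
  have hℓ : 2 ≤ r + 1 := by omega
  have hℓt : r + 1 ≤ t + 1 := by omega
  have h1 := Finset.card_sdiff_add_card_eq_card (core_subset E A)
  have h2 := Finset.card_sdiff_add_card_eq_card (core_subset E B)
  have h3 := Finset.card_sdiff_add_card_eq_card (core_subset E G)
  rw [hA.1] at h1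
  rw [hB.1] at h2
  rw [hG.1] at h3
  have h4 : A ∩ B ⊆ A \ core E A := by
    intro v hv
    rw [Finset.mem_inter] at hv
    rw [Finset.mem_sdiff]
    exact ⟨hv.1, fun h => hAB (eq_of_mem_core hℓ hℓt hA hB h hv.2)⟩
  have h5 := Finset.card_le_card h4
  obtain ⟨F, hFG, hF⟩ := Finset.exists_subset_card_eq (by omega : (A ∩ B).card ≤ (core E G).card)
  have hdis : ∀ X, IsCopy E (r + 1) (t + 1) X → X ≠ G → Disjoint F X := by
    intro X hX hXG
    rw [Finset.disjoint_left]
    exact fun v hv hvX => hXG (eq_of_mem_core hℓ hℓt hG hX (hFG hv) hvX).symm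
  obtain ⟨E', hE', Z, hZ⟩ := exists_isIsolatedCopy_of_swap hr hrt hrm hE hA hB hAB (by omega)
    (hdis A hA hAG) (hdis B hB hBG) hF
    fun e he hc => hG.2 e (he.trans (hFG.trans (core_subset E G))) hc
  exact hno E' hE' Z hZ

end Accounting

section LargeUniformity

variable {V : Type*} [DecidableEq V] [Fintype V]

theorem le_choose {a b : ℕ} (hb : 1 ≤ b) (hab : b < a) : a ≤ a.choose b := by
  induction a, hab using Nat.le_induction with
  | base => rw [Nat.succ_eq_add_one, Nat.choose_succ_self_right]
  | succ a h ih =>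
    obtain ⟨c, rfl⟩ := Nat.exists_eq_add_of_le' hb
    rw [Nat.choose_succ_succ, Nat.succ_eq_add_one]
    have : 0 < a.choose c := Nat.choose_pos (by omega)
    omega

/-- In an extremal graph, a vertex of exactly one anchored clique but outside of its core has
degree well above the minimum. -/
theorem choose_add_two_le_hdeg {E : Finset (Finset V)} {r t m : ℕ} (hr : 1 ≤ r)
    (hrm : r + 2 ≤ m) (hE : IsExtremal E (r + 2) (m + 1) t) {w : V} {A : Finset V}
    (hA : A ∈ anchored E (r + 2) t) (hw : w ∈ A) (hwc : w ∉ core E A) :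
    t.choose (r + 1) + 2 ≤ hdeg E w := by
  obtain ⟨e, he, hwe, heA⟩ : ∃ e ∈ E, w ∈ e ∧ ¬ e ⊆ A := by
    by_contra! h
    exact hwc (mem_core.2 ⟨hw, h⟩)
  have hviol : ¬ DegCond (E.erase e) (r + 2) (m + 1) t := by
    intro h
    have h1 := hE.2.2 (E.erase e) (fun f hf => hE.1 f (Finset.mem_of_mem_erase hf)) h
    have h2 := Finset.card_erase_lt_of_mem he
    omega
  unfold DegCond at hviol
  push Not at hviol
  obtain ⟨u, hu⟩ := hviol
  have huA : u ∉ A := by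
    intro huA
    have hA' : IsCopy (E.erase e) (r + 2) (t + 1) A := by
      refine ⟨(mem_anchored.1 hA).1.1, fun f hf hc => Finset.mem_erase.2 ⟨?_, ?_⟩⟩
      · rintro rfl; exact heA hf
      · exact (mem_anchored.1 hA).1.2 f hf hc
    exact absurd (choose_le_copiesAt_of_isCopy (m := m) hA' huA) (by simpa using hu)
  obtain ⟨S, huS, hS, heS⟩ : ∃ S, u ∈ S ∧ IsCopy E (r + 2) (m + 1) S ∧ e ⊆ S := by
    by_contra! hcon
    have h1 : copiesAt E (r + 2) (m + 1) u ≤ copiesAt (E.erase e) (r + 2) (m + 1) u := by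
      refine copiesAt_mono_of fun S huS hS => ⟨hS.1, fun f hf hc => Finset.mem_erase.2 ⟨?_, ?_⟩⟩
      · rintro rfl; exact hcon S huS hS hf
      · exact hS.2 f hf hc
    have h2 := hE.2.1 u
    omega
  have hne : w ≠ u := by rintro rfl; exact huA hw
  have h1 := choose_le_card_filter_pair huS (heS hwe) hne r
  rw [hS.1] at h1
  have h2 : m + 1 - 2 ≤ (m + 1 - 2).choose r := le_choose hr (by omega)
  have h3 : hdeg (A.powersetCard (r + 2)) w = t.choose (r + 1) := by
    rw [hdeg_powersetCard hw (r + 1), (mem_anchored.1 hA).1.1, Nat.add_sub_cancel]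
  rw [hdeg_eq_card_filter] at h3
  have h4 : ((A.powersetCard (r + 2)).filter fun e => w ∈ e) ∪
      ((S.powersetCard (r + 2)).filter fun e => w ∈ e ∧ u ∈ e) ⊆ E.filter fun e => w ∈ e := by
    intro f hf
    simp only [Finset.mem_union, Finset.mem_filter, Finset.mem_powersetCard] at hf ⊢
    rcases hf with hf | hf
    · exact ⟨(mem_anchored.1 hA).1.2 f hf.1.1 hf.1.2, hf.2⟩
    · exact ⟨hS.2 f hf.1.1 hf.1.2, hf.2.1⟩
  have h5 := Finset.card_le_card h4
  rw [Finset.card_union_of_disjoint] at h5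
  · rw [hdeg_eq_card_filter]
    omega
  · rw [Finset.disjoint_left]
    intro f hf hf'
    simp only [Finset.mem_filter, Finset.mem_powersetCard] at hf hf'
    exact huA (hf.1.1 hf'.2.2)

theorem choose_add_card_le_hdeg {E : Finset (Finset V)} {r t m : ℕ} (hr : 1 ≤ r)
    (hrm : r + 2 ≤ m) (hmt : m < t) (hE : IsExtremal E (r + 2) (m + 1) t) {w : V}
    (hw : w ∈ outside E (anchored E (r + 2) t)) :
    t.choose (r + 1) + (1 + ((anchored E (r + 2) t).filter fun A => w ∈ A).card) ≤ hdeg E w := by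
  rw [mem_outside] at hw
  set I := (anchored E (r + 2) t).filter fun A => w ∈ A with hI
  have hImem : ∀ A, A ∈ I ↔ A ∈ anchored E (r + 2) t ∧ w ∈ A := fun A => by rw [hI, mem_filter]
  rcases Nat.lt_trichotomy I.card 1 with h | h | h
  · obtain ⟨h1, h2⟩ := choose_le_hdeg hE.1 (by omega) (by omega) hmt.le (hE.2.1 w)
    rcases h1.eq_or_lt with h3 | h3
    · obtain ⟨A, hA, hwA⟩ := h2 h3.symm
      exact absurd hwA (hw A (mem_anchored.2 ⟨hA, w, hwA⟩))
    · omega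
  · obtain ⟨A, hA⟩ := Finset.card_eq_one.1 h
    have h1 := (hImem A).1 (by rw [hA]; exact Finset.mem_singleton_self A)
    have h2 := choose_add_two_le_hdeg hr hrm hE h1.1 h1.2 (hw A h1.1)
    omega
  · obtain ⟨J, hJ⟩ := Finset.card_pos.1 (by omega : 0 < I.card)
    have h1 := choose_add_sum_card_coreEdges_le (E := E) (r := r + 1) (t := t) (w := w)
      (by omega) (by omega) hJ (fun A hA => (mem_anchored.1 ((hImem A).1 hA).1).1)
      ((hImem J).1 hJ).2
    have h2 : ∀ A ∈ I.erase J, 3 ≤ (coreEdges E A w).card := by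
      intro A hA
      have h3 := (hImem A).1 (Finset.mem_of_mem_erase hA)
      have h4 := mem_anchored.1 h3.1
      have h5 := choose_le_card_coreEdges h4.1 h3.2 (hw A h3.1) h4.2
      have h6 : t - 1 ≤ (t - 1).choose r := le_choose hr (by omega)
      omega
    have h3 := Finset.card_nsmul_le_sum _ _ _ h2
    rw [Finset.card_erase_of_mem hJ, smul_eq_mul] at h3
    omega

theorem card_le_of_no_isolated {r t m : ℕ} (hr : 1 ≤ r) (hrm : r + 2 ≤ m) (hmt : m < t)
    (hn : t + 1 ≤ Fintype.card V)
    (hno : ∀ E' : Finset (Finset V), IsExtremal E' (r + 2) (m + 1) t →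
      ∀ Z, ¬ IsIsolatedCopy E' (r + 2) t Z) :
    4 * Fintype.card V ≤ (t + 1) ^ 2 * (t - 1).choose r + 8 * t := by
  obtain ⟨E, hE⟩ := exists_isExtremal (V := V) (r := r) (m := m) hn
  set 𝒜 := anchored E (r + 2) t with h𝒜
  have hcopy : ∀ A ∈ 𝒜, IsCopy E (r + 2) (t + 1) A := fun A hA => (mem_anchored.1 hA).1
  have h1 := sum_outside_le (𝒜 := 𝒜) (fun v => 1 + (𝒜.filter fun A => v ∈ A).card)
    (fun v => (choose_le_hdeg hE.1 (by omega) (by omega) hmt.le (hE.2.1 v)).1)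
    (fun v hv => choose_add_card_le_hdeg hr hrm hmt hE hv) (hE.sum_hdeg_le hn)
  rw [Finset.sum_add_distrib, Finset.sum_const, smul_eq_mul, mul_one,
    sum_card_sdiff_core (by omega) (by omega) hcopy] at h1
  have h2 := card_outside_add_sum (by omega) (by omega) hcopy
  set L := 𝒜.filter fun A => (A \ core E A).card < (core E A).card with hL
  have hL2 : L.card ≤ 2 := by
    by_contra! h
    obtain ⟨A, hA, B, hB, G, hG, hAB, hAG, hBG⟩ := Finset.two_lt_card.1 h
    rw [hL, mem_filter] at hA hB hG
    exact no_three_large (by omega) (by omega) (by omega) hE hno (hcopy A hA.1) (hcopy B hB.1)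
      (hcopy G hG.1) hAB hAG hBG hA.2.le hB.2.le hG.2.le
  have h3 : ∑ A ∈ 𝒜, (core E A).card ≤
      ∑ A ∈ 𝒜, ((A \ core E A).card + if A ∈ L then t else 0) := by
    refine Finset.sum_le_sum fun A hA => ?_
    split_ifs with h
    · have h4 : core E A ≠ A := fun h4 => hno E hE A (isIsolatedCopy_of_core_eq (hcopy A hA) h4)
      have h5 := Finset.card_lt_card ((core_subset E A).ssubset_of_ne h4)
      rw [(hcopy A hA).1] at h5
      omega
    · rw [hL, mem_filter] at h
      exact not_lt.1 fun h' => h ⟨hA, h'⟩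
  rw [Finset.sum_add_distrib, Finset.sum_ite_mem, Finset.sum_const, smul_eq_mul] at h3
  have h4 : (𝒜 ∩ L).card * t ≤ 2 * t :=
    Nat.mul_le_mul_right t ((Finset.card_le_card Finset.inter_subset_right).trans hL2)
  omega

end LargeUniformity

section Compression

variable {V : Type*} [DecidableEq V]

theorem exists_chain (W : Finset V) : ∃ g : ℕ → Finset V, Monotone g ∧ (∀ i, g i ⊆ W) ∧
    ∀ i, (g i).card = min i W.card := by
  refine ⟨fun i => (W.toList.take i).toFinset, fun i j hij x hx => ?_, fun i x hx => ?_,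
    fun i => ?_⟩
  · rw [List.mem_toFinset] at hx ⊢
    exact (List.take_subset_take_left _ hij) hx
  · rw [List.mem_toFinset] at hx
    exact Finset.mem_toList.1 (List.mem_of_mem_take hx)
  · rw [List.toFinset_card_of_nodup (W.nodup_toList.sublist (List.take_sublist _ _)),
      List.length_take, Finset.length_toList]

theorem pair_injective (x : V) : Function.Injective fun w : V => ({x, w} : Finset V) := by
  intro w w' h
  have h : ({x, w} : Finset V) = {x, w'} := h
  have h1 : w ∈ ({x, w'} : Finset V) := by rw [← h]; simp
  have h2 : w' ∈ ({x, w} : Finset V) := by rw [h]; simp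
  simp only [Finset.mem_insert, Finset.mem_singleton] at h1 h2
  rcases h1 with rfl | h1
  · rcases h2 with h2 | h2 <;> exact h2.symm
  · exact h1

/-- The set of vertices covered by `𝒜`. -/
def cover (𝒜 : Finset (Finset V)) : Finset V := 𝒜.biUnion id

theorem mem_cover {𝒜 : Finset (Finset V)} {v : V} : v ∈ cover 𝒜 ↔ ∃ A ∈ 𝒜, v ∈ A := by
  simp [cover]

/-- The neighbours of `x` in `U`. -/
noncomputable def nbr (E : Finset (Finset V)) (U : Finset V) (x : V) : Finset V :=
  U.filter fun u => {x, u} ∈ E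

theorem mem_nbr {E : Finset (Finset V)} {U : Finset V} {x u : V} :
    u ∈ nbr E U x ↔ u ∈ U ∧ {x, u} ∈ E := by
  simp [nbr]

variable [Fintype V]

/-- The pairs `{x, w}` with `x ∉ U` and `w ∈ f x`. -/
def stars (U : Finset V) (f : V → Finset V) : Finset (Finset V) :=
  (univ \ U).biUnion fun x => (f x).image fun w => {x, w}

theorem mem_stars {U : Finset V} {f : V → Finset V} {e : Finset V} :
    e ∈ stars U f ↔ ∃ x ∉ U, ∃ w ∈ f x, {x, w} = e := by
  simp [stars]

theorem card_stars_le (U : Finset V) (f : V → Finset V) :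
    (stars U f).card ≤ ∑ x ∈ univ \ U, (f x).card :=
  Finset.card_biUnion_le.trans (Finset.sum_le_sum fun _ _ => Finset.card_image_le)

theorem card_stars {U : Finset V} {f : V → Finset V} (hf : ∀ x, f x ⊆ U) :
    (stars U f).card = ∑ x ∈ univ \ U, (f x).card := by
  unfold stars
  rw [Finset.card_biUnion]
  · exact Finset.sum_congr rfl fun x _ => Finset.card_image_of_injective _ (pair_injective x)
  · intro x hx y hy hxy
    rw [Function.onFun, Finset.disjoint_left]
    intro e he he'
    obtain ⟨w, hw, rfl⟩ := Finset.mem_image.1 he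
    obtain ⟨w', hw', h⟩ := Finset.mem_image.1 he'
    have h1 : x ∈ ({y, w'} : Finset V) := by rw [h]; simp
    simp only [Finset.mem_insert, Finset.mem_singleton] at h1
    rcases h1 with h1 | rfl
    · exact hxy h1
    · exact (Finset.mem_sdiff.1 hx).2 (hf _ hw')

/-- Outside of the vertices covered by `𝒜` the graph `E` is kept, the edges from there to the
covered part are pushed towards the initial sets of the chain `g`. -/
noncomputable def compress (E 𝒜 : Finset (Finset V)) (g : ℕ → Finset V) : Finset (Finset V) :=
  (𝒜.biUnion fun A => A.powersetCard 2) ∪ (E.filter fun e => Disjoint e (cover 𝒜)) ∪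
    stars (cover 𝒜) fun x => g (nbr E (cover 𝒜) x).card

theorem mem_compress {E 𝒜 : Finset (Finset V)} {g : ℕ → Finset V} {e : Finset V} :
    e ∈ compress E 𝒜 g ↔ (∃ A ∈ 𝒜, e ⊆ A ∧ e.card = 2) ∨
      (e ∈ E ∧ Disjoint e (cover 𝒜)) ∨
      ∃ x ∉ cover 𝒜, ∃ w ∈ g (nbr E (cover 𝒜) x).card, {x, w} = e := by
  unfold compress
  rw [Finset.mem_union, Finset.mem_union, mem_stars, Finset.mem_filter]
  simp only [Finset.mem_biUnion, Finset.mem_powersetCard]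
  rw [or_assoc]

theorem isLGraph_compress {E 𝒜 : Finset (Finset V)} {g : ℕ → Finset V} (hE : IsLGraph 2 E)
    (hg : ∀ i, g i ⊆ cover 𝒜) : IsLGraph 2 (compress E 𝒜 g) := by
  intro e he
  rcases mem_compress.1 he with ⟨A, -, -, h⟩ | h | ⟨x, hx, w, hw, rfl⟩
  · exact h
  · exact hE e h.1
  · exact Finset.card_pair (by rintro rfl; exact hx (hg _ hw))

theorem card_compress_add_sum_le {E 𝒜 : Finset (Finset V)} {g : ℕ → Finset V}
    (h𝒜 : ∀ A ∈ 𝒜, ∀ e ⊆ A, e.card = 2 → e ∈ E) :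
    (compress E 𝒜 g).card + ∑ x ∈ univ \ cover 𝒜, (nbr E (cover 𝒜) x).card ≤
      E.card + ∑ x ∈ univ \ cover 𝒜, (g (nbr E (cover 𝒜) x).card).card := by
  set U := cover 𝒜 with hU
  set P := 𝒜.biUnion fun A => A.powersetCard 2 with hP
  have hPm : ∀ e, e ∈ P ↔ ∃ A ∈ 𝒜, e ⊆ A ∧ e.card = 2 := by simp [hP]
  have hPU : ∀ e ∈ P, e ⊆ U := by
    intro e he v hv
    obtain ⟨A, hA, h1, -⟩ := (hPm e).1 he
    exact mem_cover.2 ⟨A, hA, h1 hv⟩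
  set E₀ := E.filter fun e => Disjoint e U with hE₀
  set C := stars U (nbr E U) with hC
  have hCcard : C.card = ∑ x ∈ univ \ U, (nbr E U x).card :=
    card_stars fun x => Finset.filter_subset _ _
  have h1 : P ∪ E₀ ∪ C ⊆ E := by
    intro e he
    rw [Finset.mem_union, Finset.mem_union, hPm, hE₀, Finset.mem_filter, hC, mem_stars] at he
    rcases he with (⟨A, hA, h2, h3⟩ | he) | ⟨x, hx, w, hw, rfl⟩
    · exact h𝒜 A hA e h2 h3
    · exact he.1
    · exact (mem_nbr.1 hw).2
  have h2 := Finset.card_le_card h1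
  rw [Finset.card_union_of_disjoint, Finset.card_union_of_disjoint, hCcard] at h2
  · have h3 := Finset.card_union_le (P ∪ E₀) (stars U fun x => g (nbr E U x).card)
    have h4 := Finset.card_union_le P E₀
    have h5 := card_stars_le U fun x => g (nbr E U x).card
    change (P ∪ E₀ ∪ (stars U fun x => g (nbr E U x).card)).card + _ ≤ _
    omega
  · rw [Finset.disjoint_left]
    intro e he he'
    rw [hE₀, Finset.mem_filter] at he'
    obtain ⟨A, hA, h5, h6⟩ := (hPm e).1 he
    obtain ⟨v, hv⟩ : e.Nonempty := Finset.card_pos.1 (by omega)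
    exact Finset.disjoint_left.1 he'.2 hv (hPU e he hv)
  · rw [Finset.disjoint_right]
    intro e he he'
    rw [hC, mem_stars] at he
    obtain ⟨x, hx, w, hw, rfl⟩ := he
    rcases Finset.mem_union.1 he' with h | h
    · exact hx (hPU _ h (by simp))
    · exact Finset.disjoint_left.1 (Finset.mem_filter.1 h).2 (by simp : w ∈ ({x, w} : Finset V))
        (mem_nbr.1 hw).1

theorem copiesAt_le_copiesAt_compress {E 𝒜 : Finset (Finset V)} {g : ℕ → Finset V} {k t : ℕ}
    {G : Finset V} (hG : G ∈ 𝒜) (hg : Monotone g) (hgG : ∀ i, g i ⊆ G)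
    (hgc : ∀ i, (g i).card = min i t) {x : V} (hx : x ∉ cover 𝒜)
    (hxt : (nbr E (cover 𝒜) x).card ≤ t) :
    copiesAt E 2 k x ≤ copiesAt (compress E 𝒜 g) 2 k x := by
  set U := cover 𝒜 with hU
  have hGU : G ⊆ U := fun v hv => mem_cover.2 ⟨G, hG, hv⟩
  unfold copiesAt
  rw [Finset.card_eq_sum_card_fiberwise (f := fun S => S \ U) (t := (univ : Finset (Finset V)))
      (fun _ _ => by simp),
    Finset.card_eq_sum_card_fiberwise (f := fun S => S \ U) (t := (univ : Finset (Finset V)))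
      (fun _ _ => by simp)]
  refine Finset.sum_le_sum fun Q _ => ?_
  by_cases hex : ∃ S, (x ∈ S ∧ IsCopy E 2 k S) ∧ S \ U = Q
  swap
  · refine le_of_eq_of_le (Finset.card_eq_zero.2 ?_) (Nat.zero_le _)
    refine Finset.eq_empty_of_forall_notMem fun S hS => hex ⟨S, ?_⟩
    simpa only [Finset.mem_filter, mem_univ, true_and] using hS
  obtain ⟨S₀, hS₀⟩ := hex
  obtain ⟨⟨hxS₀, hS₀⟩, hQ⟩ := hS₀
  have hxQ : x ∈ Q := by rw [← hQ, Finset.mem_sdiff]; exact ⟨hxS₀, hx⟩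
  have hQU : ∀ q ∈ Q, q ∉ U := by
    intro q hq
    rw [← hQ, Finset.mem_sdiff] at hq
    exact hq.2
  have hQS₀ : Q ⊆ S₀ := by rw [← hQ]; exact Finset.sdiff_subset
  have hQk : Q.card ≤ k := by rw [← hS₀.1]; exact Finset.card_le_card hQS₀
  obtain ⟨q, hqQ, hq⟩ := Finset.exists_min_image Q (fun q => (nbr E U q).card) ⟨x, hxQ⟩
  have hqt : (nbr E U q).card ≤ t := (hq x hxQ).trans hxt
  calc _ ≤ ((nbr E U q).powersetCard (k - Q.card)).card := by
        refine Finset.card_le_card_of_injOn (fun S => S ∩ U) ?_ ?_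
        · intro S hS
          simp only [Finset.coe_filter, Finset.mem_filter, mem_univ, true_and,
            Set.mem_ofPred_eq] at hS
          obtain ⟨⟨hxS, hS⟩, hSQ⟩ := hS
          rw [Finset.mem_coe, Finset.mem_powersetCard]
          constructor
          · intro u hu
            rw [Finset.mem_inter] at hu
            rw [mem_nbr]
            refine ⟨hu.2, hS.2 _ ?_ (Finset.card_pair ?_)⟩
            · rw [← hSQ, Finset.mem_sdiff] at hqQ
              intro z hz
              simp only [Finset.mem_insert, Finset.mem_singleton] at hz
              rcases hz with rfl | rfl
              · exact hqQ.1
              · exact hu.1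
            · rintro rfl; exact hQU _ hqQ hu.2
          · have h1 := Finset.card_sdiff_add_card_inter S U
            rw [hSQ, hS.1] at h1
            change (S ∩ U).card = _
            omega
        · intro S hS S' hS' h
          simp only [Finset.coe_filter, Finset.mem_filter, mem_univ, true_and,
            Set.mem_ofPred_eq] at hS hS'
          have h : S ∩ U = S' ∩ U := h
          rw [← Finset.sdiff_union_inter S U, ← Finset.sdiff_union_inter S' U, h, hS.2, hS'.2]
    _ = ((g (nbr E U q).card).powersetCard (k - Q.card)).card := by
        rw [Finset.card_powersetCard, Finset.card_powersetCard, hgc, min_eq_left hqt]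
    _ ≤ _ := by
        have hdis : ∀ P ∈ (g (nbr E U q).card).powersetCard (k - Q.card), Disjoint Q P := by
          intro P hP
          rw [Finset.mem_powersetCard] at hP
          rw [Finset.disjoint_left]
          exact fun v hv hvP => hQU v hv (hGU (hgG _ (hP.1 hvP)))
        refine Finset.card_le_card_of_injOn (fun P => Q ∪ P) ?_ ?_
        · intro P hP
          have hd := hdis P hP
          rw [Finset.mem_coe, Finset.mem_powersetCard] at hP
          simp only [Finset.coe_filter, Finset.mem_filter, mem_univ, true_and,
            Set.mem_ofPred_eq]
          refine ⟨⟨Finset.mem_union_left _ hxQ, ?_, ?_⟩, ?_⟩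
          · rw [Finset.card_union_of_disjoint hd, hP.2]
            omega
          · intro e he hc
            rw [mem_compress]
            obtain ⟨a, b, hab, rfl⟩ := Finset.card_eq_two.1 hc
            have ha : a ∈ Q ∪ P := he (by simp)
            have hb : b ∈ Q ∪ P := he (by simp)
            have hcross : ∀ a ∈ Q, ∀ b ∈ P, ∃ x ∉ U, ∃ w ∈ g (nbr E U x).card,
                ({x, w} : Finset V) = {a, b} := fun a ha b hb =>
              ⟨a, hQU a ha, b, hg (hq a ha) (hP.1 hb), rfl⟩
            rcases Finset.mem_union.1 ha with ha | ha <;> rcases Finset.mem_union.1 hb with hb | hb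
            · refine Or.inr (Or.inl ⟨hS₀.2 _ ?_ hc, ?_⟩)
              · intro z hz
                simp only [Finset.mem_insert, Finset.mem_singleton] at hz
                rcases hz with rfl | rfl
                · exact hQS₀ ha
                · exact hQS₀ hb
              · rw [Finset.disjoint_left]
                intro z hz
                simp only [Finset.mem_insert, Finset.mem_singleton] at hz
                rcases hz with rfl | rfl
                · exact hQU _ ha
                · exact hQU _ hb
            · exact Or.inr (Or.inr (hcross a ha b hb))
            · rw [Finset.pair_comm]
              exact Or.inr (Or.inr (hcross b hb a ha))
            · refine Or.inl ⟨G, hG, ?_, hc⟩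
              intro z hz
              simp only [Finset.mem_insert, Finset.mem_singleton] at hz
              rcases hz with rfl | rfl
              · exact hgG _ (hP.1 ha)
              · exact hgG _ (hP.1 hb)
          · ext v
            rw [Finset.mem_sdiff, Finset.mem_union]
            constructor
            · rintro ⟨h | h, h'⟩
              · exact h
              · exact absurd (hGU (hgG _ (hP.1 h))) h'
            · exact fun h => ⟨Or.inl h, hQU v h⟩
        · intro P hP P' hP' h
          have h : Q ∪ P = Q ∪ P' := h
          rw [← Finset.union_sdiff_cancel_left (hdis P hP), h,
            Finset.union_sdiff_cancel_left (hdis P' hP')]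

theorem hdeg_le_hdeg_compress {E 𝒜 : Finset (Finset V)} {g : ℕ → Finset V} {t : ℕ}
    (hE : IsLGraph 2 E) (hgU : ∀ i, g i ⊆ cover 𝒜)
    (hgc : ∀ i, (g i).card = min i t) {x : V} (hx : x ∉ cover 𝒜)
    (hxt : (nbr E (cover 𝒜) x).card ≤ t) : hdeg E x ≤ hdeg (compress E 𝒜 g) x := by
  set U := cover 𝒜 with hU
  set E₀ := E.filter fun e => x ∈ e ∧ Disjoint e U with hE₀
  have h1 : (E.filter fun e => x ∈ e) ⊆ E₀ ∪ (nbr E U x).image fun w => {x, w} := by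
    intro e he
    rw [Finset.mem_filter] at he
    rw [Finset.mem_union, hE₀, Finset.mem_filter]
    by_cases h : Disjoint e U
    · exact Or.inl ⟨he.1, he.2, h⟩
    · right
      obtain ⟨w, hwe, hwU⟩ := Finset.not_disjoint_iff.1 h
      have hxw : x ≠ w := by rintro rfl; exact hx hwU
      have h2 : ({x, w} : Finset V) = e := by
        refine Finset.eq_of_subset_of_card_le ?_ (by rw [hE e he.1, Finset.card_pair hxw])
        intro z hz
        simp only [Finset.mem_insert, Finset.mem_singleton] at hz
        rcases hz with rfl | rfl
        · exact he.2
        · exact hwe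
      exact Finset.mem_image.2 ⟨w, mem_nbr.2 ⟨hwU, h2 ▸ he.1⟩, h2⟩
  have h2 : E₀ ∪ (g (nbr E U x).card).image (fun w => {x, w}) ⊆
      (compress E 𝒜 g).filter fun e => x ∈ e := by
    intro e he
    rw [Finset.mem_filter, mem_compress]
    rw [Finset.mem_union, hE₀, Finset.mem_filter, Finset.mem_image] at he
    rcases he with he | ⟨w, hw, rfl⟩
    · exact ⟨Or.inr (Or.inl ⟨he.1, he.2.2⟩), he.2.1⟩
    · exact ⟨Or.inr (Or.inr ⟨x, hx, w, hw, rfl⟩), by simp⟩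
  have h3 : (E₀ ∪ (g (nbr E U x).card).image (fun w => {x, w})).card =
      E₀.card + (nbr E U x).card := by
    rw [Finset.card_union_of_disjoint, Finset.card_image_of_injective _ (pair_injective x), hgc,
      min_eq_left hxt]
    rw [Finset.disjoint_left]
    intro e he he'
    rw [hE₀, Finset.mem_filter] at he
    obtain ⟨w, hw, rfl⟩ := Finset.mem_image.1 he'
    exact Finset.disjoint_left.1 he.2.2 (by simp : w ∈ ({x, w} : Finset V)) (hgU _ hw)
  rw [hdeg_eq_card_filter, hdeg_eq_card_filter]
  calc _ ≤ _ := Finset.card_le_card h1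
    _ ≤ E₀.card + (nbr E U x).card :=
        (Finset.card_union_le _ _).trans (Nat.add_le_add_left Finset.card_image_le _)
    _ ≤ _ := h3 ▸ Finset.card_le_card h2

/-- Compressing an extremal graph towards an anchored clique `G`. -/
theorem exists_compression {E : Finset (Finset V)} {t m : ℕ} (hm : 2 ≤ m) (hmt : m ≤ t)
    (hE : IsExtremal E 2 (m + 1) t) {G : Finset V} (hG : G ∈ anchored E 2 t) :
    ∃ E' : Finset (Finset V), IsExtremal E' 2 (m + 1) t ∧
      (∀ A ∈ anchored E 2 t, A ∈ anchored E' 2 t) ∧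
      (∀ A ∈ anchored E 2 t, A ≠ G → ∀ w ∈ A, (∀ B ∈ anchored E 2 t, w ∈ B → B = A) →
        w ∈ core E' A) ∧
      ∀ v, (∀ A ∈ anchored E 2 t, v ∉ A) → t + 1 ≤ hdeg E' v := by
  set 𝒜 := anchored E 2 t with h𝒜
  have hcopy : ∀ A ∈ 𝒜, IsCopy E 2 (t + 1) A := fun A hA => (mem_anchored.1 hA).1
  obtain ⟨v₁, hv₁⟩ := (mem_anchored.1 hG).2
  obtain ⟨g, hg, hgW, hgc⟩ := exists_chain (G.erase v₁)
  rw [Finset.card_erase_of_mem (core_subset _ _ hv₁), (hcopy G hG).1, Nat.add_sub_cancel] at hgc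
  have hgG : ∀ i, g i ⊆ G := fun i => (hgW i).trans (Finset.erase_subset _ _)
  set U := cover 𝒜 with hU
  have hGU : G ⊆ U := fun v hv => mem_cover.2 ⟨G, hG, hv⟩
  have hgU : ∀ i, g i ⊆ U := fun i => (hgG i).trans hGU
  set E' := compress E 𝒜 g with hE'
  have hcopy' : ∀ A ∈ 𝒜, IsCopy E' 2 (t + 1) A := fun A hA =>
    ⟨(hcopy A hA).1, fun e he hc => mem_compress.2 (Or.inl ⟨A, hA, he, hc⟩)⟩
  have hL : IsLGraph 2 E' := isLGraph_compress hE.1 hgU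
  have hdeg' : DegCond E' 2 (m + 1) t := by
    intro v
    by_cases hv : v ∈ U
    · obtain ⟨A, hA, hvA⟩ := mem_cover.1 hv
      exact choose_le_copiesAt_of_isCopy (hcopy' A hA) hvA
    rcases le_or_gt (nbr E U v).card t with h | h
    · exact (hE.2.1 v).trans (copiesAt_le_copiesAt_compress hG hg hgG hgc hv h)
    · set W := g (nbr E U v).card with hW
      have hvW : v ∉ W := fun h => hv (hgU _ h)
      refine choose_le_copiesAt_of_isCopy (A := insert v W) ⟨?_, ?_⟩ (Finset.mem_insert_self _ _)
      · rw [Finset.card_insert_of_notMem hvW, hgc, min_eq_right h.le]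
      · intro e he hc
        rw [mem_compress]
        by_cases hve : v ∈ e
        · obtain ⟨w, hw⟩ : (e.erase v).Nonempty := by
            rw [← Finset.card_pos, Finset.card_erase_of_mem hve, hc]; norm_num
          rw [Finset.mem_erase] at hw
          refine Or.inr (Or.inr ⟨v, hv, w, Finset.mem_of_mem_insert_of_ne (he hw.2) hw.1, ?_⟩)
          refine Finset.eq_of_subset_of_card_le ?_ (by rw [hc, Finset.card_pair hw.1.symm])
          intro z hz
          simp only [Finset.mem_insert, Finset.mem_singleton] at hz
          rcases hz with rfl | rfl
          · exact hve
          · exact hw.2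
        · exact Or.inl ⟨G, hG, ((Finset.subset_insert_iff_of_notMem hve).1 he).trans (hgG _), hc⟩
  have hsum := card_compress_add_sum_le (E := E) (𝒜 := 𝒜) (g := g) fun A hA => (hcopy A hA).2
  rw [← hU, ← hE'] at hsum
  have hmin := hE.2.2 E' hL hdeg'
  have hle : ∀ x ∈ univ \ U, (g (nbr E U x).card).card ≤ (nbr E U x).card := fun x _ => by
    rw [hgc]; exact min_le_left _ _
  have hle' := Finset.sum_le_sum hle
  have heq := (Finset.sum_eq_sum_iff_of_le hle).1 (by omega)
  have hnbr : ∀ x, x ∉ U → (nbr E U x).card ≤ t := by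
    intro x hx
    have := heq x (Finset.mem_sdiff.2 ⟨mem_univ x, hx⟩)
    rw [hgc] at this
    omega
  have hcore : ∀ A ∈ 𝒜, A ≠ G → ∀ w ∈ A, (∀ B ∈ 𝒜, w ∈ B → B = A) → w ∈ core E' A := by
    intro A hA hAG w hw huniq
    refine mem_core.2 ⟨hw, fun e he hwe => ?_⟩
    rcases mem_compress.1 he with ⟨B, hB, h, -⟩ | h | ⟨x, hx, w', hw', rfl⟩
    · rwa [← huniq B hB (h hwe)]
    · exact absurd (mem_cover.2 ⟨A, hA, hw⟩) (Finset.disjoint_left.1 h.2 hwe)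
    · simp only [Finset.mem_insert, Finset.mem_singleton] at hwe
      rcases hwe with rfl | rfl
      · exact absurd (mem_cover.2 ⟨A, hA, hw⟩) hx
      · exact absurd (huniq G hG (hgG _ hw')).symm hAG
  refine ⟨E', ⟨hL, hdeg', fun E'' h h' => le_trans (by omega) (hE.2.2 E'' h h')⟩, ?_, hcore, ?_⟩
  · intro A hA
    refine mem_anchored.2 ⟨hcopy' A hA, ?_⟩
    by_cases hAG : A = G
    · subst hAG
      refine ⟨v₁, mem_core.2 ⟨core_subset _ _ hv₁, fun e he hwe => ?_⟩⟩
      rcases mem_compress.1 he with ⟨B, hB, h, -⟩ | h | ⟨x, hx, w', hw', rfl⟩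
      · rwa [eq_of_mem_core le_rfl (by omega) (hcopy A hA) (hcopy B hB) hv₁ (h hwe)]
      · exact absurd (hGU (core_subset _ _ hv₁)) (Finset.disjoint_left.1 h.2 hwe)
      · simp only [Finset.mem_insert, Finset.mem_singleton] at hwe
        rcases hwe with rfl | rfl
        · exact absurd (hGU (core_subset _ _ hv₁)) hx
        · exact absurd (hgW _ hw') (Finset.notMem_erase _ _)
    · obtain ⟨w, hw⟩ := (mem_anchored.1 hA).2
      exact ⟨w, hcore A hA hAG w (core_subset _ _ hw) fun B hB hwB =>
        (eq_of_mem_core le_rfl (by omega) (hcopy A hA) (hcopy B hB) hw hwB).symm⟩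
  · intro v hv
    have hvU : v ∉ U := fun h => by
      obtain ⟨A, hA, h⟩ := mem_cover.1 h
      exact hv A hA h
    refine le_trans ?_ (hdeg_le_hdeg_compress hE.1 hgU hgc hvU (hnbr v hvU))
    obtain ⟨h1, h2⟩ := choose_le_hdeg hE.1 le_rfl (by omega) hmt (hE.2.1 v)
    rw [Nat.choose_one_right] at h1 h2
    rcases h1.eq_or_lt with h3 | h3
    · obtain ⟨A, hA, hvA⟩ := h2 h3.symm
      exact absurd (core_subset _ _ hvA) (hv A (mem_anchored.2 ⟨hA, v, hvA⟩))
    · exact h3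

end Compression

section Graphs

variable {V : Type*} [DecidableEq V]

/-- The vertices of `A` which lie in no other member of `𝒜`. -/
noncomputable def privateVerts (𝒜 : Finset (Finset V)) (A : Finset V) : Finset V :=
  A.filter fun w => ∀ B ∈ 𝒜, w ∈ B → B = A

theorem mem_privateVerts {𝒜 : Finset (Finset V)} {A : Finset V} {w : V} :
    w ∈ privateVerts 𝒜 A ↔ w ∈ A ∧ ∀ B ∈ 𝒜, w ∈ B → B = A := by
  simp [privateVerts]

theorem privateVerts_subset (𝒜 : Finset (Finset V)) (A : Finset V) : privateVerts 𝒜 A ⊆ A :=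
  fun _ hw => (mem_privateVerts.1 hw).1

theorem card_union_le_hdeg_add_one {E : Finset (Finset V)} {k : ℕ} {A B : Finset V} {w : V}
    (hA : IsCopy E 2 k A) (hB : IsCopy E 2 k B) (hwA : w ∈ A) (hwB : w ∈ B) :
    (A ∪ B).card ≤ hdeg E w + 1 := by
  rw [← Finset.card_erase_add_one (Finset.mem_union_left B hwA), hdeg_eq_card_filter]
  refine Nat.add_le_add_right ?_ 1
  refine Finset.card_le_card_of_injOn (fun u => {w, u}) ?_ (pair_injective w).injOn
  intro u hu
  rw [Finset.mem_coe, Finset.mem_erase, Finset.mem_union] at hu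
  rw [Finset.mem_coe, Finset.mem_filter]
  have hc : ({w, u} : Finset V).card = 2 := Finset.card_pair hu.1.symm
  refine ⟨?_, by simp⟩
  rcases hu.2 with h | h
  · exact hA.2 _ (Finset.insert_subset hwA (Finset.singleton_subset_iff.2 h)) hc
  · exact hB.2 _ (Finset.insert_subset hwB (Finset.singleton_subset_iff.2 h)) hc

variable [Fintype V]

omit [Fintype V] in
theorem core_eq_privateVerts {E 𝒜 : Finset (Finset V)} {k : ℕ} {A : Finset V} (hk : 2 ≤ k)
    (hcopy : ∀ B ∈ 𝒜, IsCopy E 2 k B) (hA : A ∈ 𝒜)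
    (h : ∀ w ∈ A, (∀ B ∈ 𝒜, w ∈ B → B = A) → w ∈ core E A) :
    core E A = privateVerts 𝒜 A := by
  ext w
  rw [mem_privateVerts]
  constructor
  · exact fun hw => ⟨core_subset _ _ hw, fun B hB hwB =>
      (eq_of_mem_core le_rfl hk (hcopy A hA) (hcopy B hB) hw hwB).symm⟩
  · exact fun hw => h w hw.1 hw.2

/-- Compress towards `G`, then trade `A` and `B`. -/
theorem false_of_compress_swap {E : Finset (Finset V)} {t m : ℕ} {A B G F : Finset V}
    (hm : 2 ≤ m) (hmt : m ≤ t) (hE : IsExtremal E 2 (m + 1) t)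
    (hno : ∀ E' : Finset (Finset V), IsExtremal E' 2 (m + 1) t → ∀ Z, ¬ IsIsolatedCopy E' 2 t Z)
    (hA : A ∈ anchored E 2 t) (hB : B ∈ anchored E 2 t) (hG : G ∈ anchored E 2 t)
    (hAB : A ≠ B) (hAG : A ≠ G) (hBG : B ≠ G)
    (hcA : t + 1 ≤ 2 * (privateVerts (anchored E 2 t) A).card)
    (hcB : t + 1 ≤ 2 * (privateVerts (anchored E 2 t) B).card)
    (hFA : Disjoint F A) (hFB : Disjoint F B) (hF : F.card = (A ∩ B).card)
    (hFG : F ⊆ G ∨ F.card ≤ 1) : False := by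
  obtain ⟨E', hE', h1, h2, -⟩ := exists_compression hm hmt hE hG
  have hcopy : ∀ B ∈ anchored E 2 t, IsCopy E' 2 (t + 1) B := fun B hB =>
    (mem_anchored.1 (h1 B hB)).1
  have h3 := core_eq_privateVerts (by omega) hcopy hA (h2 A hA hAG)
  have h4 := core_eq_privateVerts (by omega) hcopy hB (h2 B hB hBG)
  have h5 := Finset.card_sdiff_add_card_eq_card (core_subset E' A)
  rw [(hcopy A hA).1] at h5
  rw [← h3] at hcA
  rw [← h4] at hcB
  obtain ⟨E'', hE'', Z, hZ⟩ := exists_isIsolatedCopy_of_swap (r := 1) le_rfl (by omega)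
    (by omega) hE' (hcopy A hA) (hcopy B hB) hAB (by omega) hFA hFB hF fun e he hc => by
      rcases hFG with h | h
      · exact (hcopy G hG).2 e (he.trans h) hc
      · have := Finset.card_le_card he
        omega
  exact hno E'' hE'' Z hZ

omit [Fintype V] in
theorem card_inter_add_card_privateVerts_le {𝒜 : Finset (Finset V)} {A B : Finset V} (hB : B ∈ 𝒜)
    (hAB : A ≠ B) : (A ∩ B).card + (privateVerts 𝒜 A).card ≤ A.card := by
  rw [← Finset.card_union_of_disjoint]
  · exact Finset.card_le_card (Finset.union_subset Finset.inter_subset_left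
      (privateVerts_subset _ _))
  · rw [Finset.disjoint_left]
    intro v hv hv'
    exact hAB ((mem_privateVerts.1 hv').2 B hB (Finset.mem_inter.1 hv).2).symm

theorem no_three_private {E : Finset (Finset V)} {t m : ℕ} {A B G : Finset V}
    (hm : 2 ≤ m) (hmt : m ≤ t) (hE : IsExtremal E 2 (m + 1) t)
    (hno : ∀ E' : Finset (Finset V), IsExtremal E' 2 (m + 1) t → ∀ Z, ¬ IsIsolatedCopy E' 2 t Z)
    (hA : A ∈ anchored E 2 t) (hB : B ∈ anchored E 2 t) (hG : G ∈ anchored E 2 t)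
    (hAB : A ≠ B) (hAG : A ≠ G) (hBG : B ≠ G)
    (hcA : t + 1 ≤ 2 * (privateVerts (anchored E 2 t) A).card)
    (hcB : t + 1 ≤ 2 * (privateVerts (anchored E 2 t) B).card)
    (hcG : t + 1 ≤ 2 * (privateVerts (anchored E 2 t) G).card) : False := by
  have h1 := card_inter_add_card_privateVerts_le hB hAB
  rw [(mem_anchored.1 hA).1.1] at h1
  obtain ⟨F, hFG, hF⟩ := Finset.exists_subset_card_eq
    (by omega : (A ∩ B).card ≤ (privateVerts (anchored E 2 t) G).card)
  have hdis : ∀ X ∈ anchored E 2 t, X ≠ G → Disjoint F X := by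
    intro X hX hXG
    rw [Finset.disjoint_left]
    exact fun v hv hvX => hXG ((mem_privateVerts.1 (hFG hv)).2 X hX hvX)
  exact false_of_compress_swap hm hmt hE hno hA hB hG hAB hAG hBG hcA hcB (hdis A hA hAG)
    (hdis B hB hBG) hF (Or.inl (hFG.trans (privateVerts_subset _ _)))

theorem one_lt_card_inter {E : Finset (Finset V)} {t m : ℕ} {A B : Finset V}
    (hm : 2 ≤ m) (hmt : m ≤ t) (hE : IsExtremal E 2 (m + 1) t)
    (hno : ∀ E' : Finset (Finset V), IsExtremal E' 2 (m + 1) t → ∀ Z, ¬ IsIsolatedCopy E' 2 t Z)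
    (hn : 2 * (t + 1) ≤ Fintype.card V) (h3 : 2 < (anchored E 2 t).card)
    (hA : A ∈ anchored E 2 t) (hB : B ∈ anchored E 2 t) (hAB : A ≠ B)
    (hcA : t + 1 ≤ 2 * (privateVerts (anchored E 2 t) A).card)
    (hcB : t + 1 ≤ 2 * (privateVerts (anchored E 2 t) B).card) : 1 < (A ∩ B).card := by
  by_contra! hs
  obtain ⟨G, hG, hG'⟩ := Finset.exists_mem_notMem_of_card_lt_card
    (lt_of_le_of_lt Finset.card_le_two h3 : ({A, B} : Finset (Finset V)).card < _)
  simp only [Finset.mem_insert, Finset.mem_singleton, not_or] at hG'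
  have h1 := Finset.card_union_add_card_inter A B
  rw [(mem_anchored.1 hA).1.1, (mem_anchored.1 hB).1.1] at h1
  have h2 := Finset.card_sdiff_add_card_eq_card (Finset.subset_univ (A ∪ B))
  rw [Finset.card_univ] at h2
  obtain ⟨F, hFs, hF⟩ := Finset.exists_subset_card_eq
    (by omega : (A ∩ B).card ≤ (univ \ (A ∪ B)).card)
  have hd : Disjoint F (A ∪ B) := Finset.disjoint_of_subset_left hFs Finset.sdiff_disjoint
  rw [Finset.disjoint_union_right] at hd
  exact false_of_compress_swap hm hmt hE hno hA hB hG hAB (Ne.symm hG'.1) (Ne.symm hG'.2) hcA hcB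
    hd.1 hd.2 hF (Or.inr (by omega))

theorem sum_core_le_two_mul {E 𝒜 : Finset (Finset V)} {t : ℕ} (ht : 1 ≤ t)
    (hcopy : ∀ A ∈ 𝒜, IsCopy E 2 (t + 1) A) {w : V} (hw : w ∈ outside E 𝒜) {A B : Finset V}
    (hA : A ∈ 𝒜) (hB : B ∈ 𝒜) (hwA : w ∈ A) (hwB : w ∈ B) (hAB : A ≠ B) :
    2 * t + ∑ C ∈ 𝒜.filter (fun C => w ∈ C), (core E C).card ≤ 2 * hdeg E w := by
  set I := 𝒜.filter fun C => w ∈ C with hI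
  have hImem : ∀ C, C ∈ I ↔ C ∈ 𝒜 ∧ w ∈ C := fun C => by rw [hI, mem_filter]
  have key : ∀ J ∈ I, t + ∑ C ∈ I.erase J, (core E C).card ≤ hdeg E w := by
    intro J hJ
    have h1 := choose_add_sum_card_coreEdges_le (r := 1) le_rfl ht hJ
      (fun C hC => hcopy C ((hImem C).1 hC).1) ((hImem J).1 hJ).2
    rw [Nat.choose_one_right] at h1
    refine le_trans (Nat.add_le_add_left (Finset.sum_le_sum fun C hC => ?_) t) h1
    have h2 := (hImem C).1 (Finset.mem_of_mem_erase hC)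
    exact card_core_le_card_coreEdges (hcopy C h2.1) h2.2 (mem_outside.1 hw C h2.1)
  have hAI := (hImem A).2 ⟨hA, hwA⟩
  have hBI := (hImem B).2 ⟨hB, hwB⟩
  have h1 := key A hAI
  have h2 := key B hBI
  have h3 := Finset.add_sum_erase I (fun C => (core E C).card) hAI
  have h4 : (core E A).card ≤ ∑ C ∈ I.erase B, (core E C).card :=
    Finset.single_le_sum (f := fun C => (core E C).card) (fun _ _ => Nat.zero_le _)
      (Finset.mem_erase.2 ⟨hAB, hAI⟩)
  omega

/-- Cliques more than half of which is shared have small cores in total. -/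
theorem sum_core_le {E 𝒜 ℬ : Finset (Finset V)} {t : ℕ} (ht : 1 ≤ t)
    (hcopy : ∀ A ∈ 𝒜, IsCopy E 2 (t + 1) A) (hℬ : ℬ ⊆ 𝒜)
    (hcore : ∀ A ∈ ℬ, core E A = privateVerts 𝒜 A)
    (hsmall : ∀ A ∈ ℬ, 2 * (core E A).card < t + 1)
    (hexc : 4 * ∑ v ∈ outside E 𝒜, (hdeg E v - t) ≤ (t + 1) ^ 2) :
    ∑ A ∈ ℬ, (core E A).card ≤ t := by
  have h1 := sum_sdiff_core le_rfl (by omega) hcopy hℬ fun A => (core E A).card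
  have h2 : ∀ w ∈ outside E 𝒜, ∑ A ∈ ℬ.filter (fun A => w ∈ A), (core E A).card ≤
      2 * (hdeg E w - t) := by
    intro w hw
    rcases Finset.eq_empty_or_nonempty (ℬ.filter fun A => w ∈ A) with h | ⟨A, hA⟩
    · rw [h, Finset.sum_empty]; exact Nat.zero_le _
    rw [mem_filter] at hA
    have hwA := mem_outside.1 hw A (hℬ hA.1)
    rw [hcore A hA.1, mem_privateVerts] at hwA
    push Not at hwA
    obtain ⟨B, hB, hwB, hBA⟩ := hwA hA.2
    have h3 := sum_core_le_two_mul ht hcopy hw (hℬ hA.1) hB hA.2 hwB (Ne.symm hBA)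
    have h4 : ∑ A ∈ ℬ.filter (fun A => w ∈ A), (core E A).card ≤
        ∑ C ∈ 𝒜.filter (fun C => w ∈ C), (core E C).card :=
      Finset.sum_le_sum_of_subset (Finset.filter_subset_filter _ hℬ)
    omega
  have h3 := Finset.sum_le_sum h2
  rw [h1, ← Finset.mul_sum] at h3
  have h4 : ∑ A ∈ ℬ, (t + 2) * (core E A).card ≤
      ∑ A ∈ ℬ, 2 * ((A \ core E A).card * (core E A).card) := by
    refine Finset.sum_le_sum fun A hA => ?_
    have h5 := Finset.card_sdiff_add_card_eq_card (core_subset E A)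
    rw [(hcopy A (hℬ hA)).1] at h5
    have h6 := hsmall A hA
    rw [← mul_assoc]
    exact Nat.mul_le_mul_right _ (by omega)
  rw [← Finset.mul_sum, ← Finset.mul_sum] at h4
  by_contra! h
  have h5 : (t + 2) * (t + 1) ≤ (t + 2) * ∑ A ∈ ℬ, (core E A).card :=
    Nat.mul_le_mul_left _ h
  nlinarith

theorem card_le_of_no_isolated_graph {t m : ℕ} (hm : 2 ≤ m) (hmt : m < t)
    (hn : t + 1 ≤ Fintype.card V)
    (hno : ∀ E' : Finset (Finset V), IsExtremal E' 2 (m + 1) t → ∀ Z, ¬ IsIsolatedCopy E' 2 t Z) :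
    4 * Fintype.card V ≤ (t + 1) ^ 2 + 8 * t := by
  obtain ⟨E₀, hE₀⟩ := exists_isExtremal (V := V) (r := 0) (m := m) hn
  rw [Nat.zero_add] at hE₀
  set 𝒜 := anchored E₀ 2 t with h𝒜
  -- bounds which hold for every extremal graph in which all members of `𝒜` are anchored
  have hcoreT : ∀ E : Finset (Finset V), IsExtremal E 2 (m + 1) t → ∀ A, IsCopy E 2 (t + 1) A →
      (core E A).card ≤ t := by
    intro E hE A hA
    have h4 : core E A ≠ A := fun h4 => hno E hE A (isIsolatedCopy_of_core_eq hA h4)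
    have h5 := Finset.card_lt_card ((core_subset E A).ssubset_of_ne h4)
    rw [hA.1] at h5
    omega
  have hdegt : ∀ E : Finset (Finset V), IsExtremal E 2 (m + 1) t → ∀ v, t ≤ hdeg E v := by
    intro E hE v
    have h := (choose_le_hdeg hE.1 le_rfl (by omega) hmt.le (hE.2.1 v)).1
    rwa [Nat.choose_one_right] at h
  have hsum : ∀ E : Finset (Finset V), IsExtremal E 2 (m + 1) t → ∀ f : V → ℕ,
      (∀ v ∈ outside E 𝒜, t + f v ≤ hdeg E v) →
        4 * ∑ v ∈ outside E 𝒜, f v ≤ (t + 1) ^ 2 := by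
    intro E hE f hf
    refine sum_outside_le (V := V) f (hdegt E hE) hf ?_
    have h := IsExtremal.sum_hdeg_le (r := 0) hE hn
    simpa using h
  by_contra! hbig
  by_cases h𝒜2 : 𝒜.card ≤ 2
  · have hcopy : ∀ A ∈ 𝒜, IsCopy E₀ 2 (t + 1) A := fun A hA => (mem_anchored.1 hA).1
    have h1 := hsum E₀ hE₀ (fun _ => 1) fun v hv => by
      obtain ⟨h1, h2⟩ := choose_le_hdeg hE₀.1 le_rfl (by omega) hmt.le (hE₀.2.1 v)
      rw [Nat.choose_one_right] at h1 h2
      rcases h1.eq_or_lt with h3 | h3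
      · obtain ⟨A, hA, hvA⟩ := h2 h3.symm
        exact absurd hvA (mem_outside.1 hv A (mem_anchored.2 ⟨hA, v, hvA⟩))
      · exact h3
    have h2 := card_outside_add_sum le_rfl (by omega) hcopy
    have h3 := Finset.sum_le_card_nsmul 𝒜 (fun A => (core E₀ A).card) t
      fun A hA => hcoreT E₀ hE₀ A (hcopy A hA)
    have h4 := Nat.mul_le_mul_right t h𝒜2
    rw [smul_eq_mul] at h3
    rw [Finset.sum_const, smul_eq_mul, mul_one] at h1
    omega
  push Not at h𝒜2
  obtain ⟨A₁, hA₁, hmax⟩ := Finset.exists_max_image 𝒜 (fun A => (privateVerts 𝒜 A).card)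
    (Finset.card_pos.1 (by omega))
  obtain ⟨E, hE, hanch, hpriv, hfar⟩ := exists_compression hm hmt.le hE₀ hA₁
  have hcopy : ∀ A ∈ 𝒜, IsCopy E 2 (t + 1) A := fun A hA => (mem_anchored.1 (hanch A hA)).1
  have hcore : ∀ A ∈ 𝒜, A ≠ A₁ → core E A = privateVerts 𝒜 A := fun A hA hne =>
    core_eq_privateVerts (by omega) hcopy hA (hpriv A hA hne)
  have hout : ∀ v ∈ outside E 𝒜, t + 1 ≤ hdeg E v := by
    intro v hv
    by_cases h : ∀ A ∈ 𝒜, v ∉ A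
    · exact hfar v h
    · push Not at h
      obtain ⟨A, hA, hvA⟩ := h
      by_contra! hlt
      refine mem_outside.1 hv A hA (mem_core_of_hdeg_le (r := 1) (hcopy A hA) hvA ?_)
      rw [Nat.choose_one_right]
      omega
  have hexc := hsum E hE (fun v => hdeg E v - t) fun v _ => by
    have := hdegt E hE v
    omega
  set X := 𝒜.filter fun A => A = A₁ ∨ t + 1 ≤ 2 * (privateVerts 𝒜 A).card with hX
  have hXm : ∀ A, A ∈ X ↔ A ∈ 𝒜 ∧ (A = A₁ ∨ t + 1 ≤ 2 * (privateVerts 𝒜 A).card) :=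
    fun A => by rw [hX, mem_filter]
  have hA₁X : A₁ ∈ X := (hXm A₁).2 ⟨hA₁, Or.inl rfl⟩
  have hrest : ∑ A ∈ 𝒜 \ X, (core E A).card ≤ t := by
    have h1 : ∀ A ∈ 𝒜 \ X, core E A = privateVerts 𝒜 A := fun A hA => by
      rw [Finset.mem_sdiff] at hA
      exact hcore A hA.1 fun h => hA.2 (h ▸ hA₁X)
    refine sum_core_le (by omega) hcopy Finset.sdiff_subset h1 (fun A hA => ?_) hexc
    rw [h1 A hA]
    rw [Finset.mem_sdiff, hXm] at hA
    by_contra! h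
    exact hA.2 ⟨hA.1, Or.inr h⟩
  have htotal := card_outside_add_sum le_rfl (by omega) hcopy
  have hXsub : X ⊆ 𝒜 := fun A hA => ((hXm A).1 hA).1
  rw [← Finset.sum_sdiff hXsub] at htotal
  by_cases hX1 : ∃ B ∈ X, B ≠ A₁
  swap
  · have hX' : X = {A₁} := by
      refine Finset.eq_singleton_iff_unique_mem.2 ⟨hA₁X, fun B hB => ?_⟩
      by_contra h
      exact hX1 ⟨B, hB, h⟩
    rw [hX', Finset.sum_singleton] at htotal
    rw [hX'] at hrest
    have h1 := hcoreT E hE A₁ (hcopy A₁ hA₁)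
    have h2 := hsum E hE (fun _ => 1) hout
    rw [Finset.sum_const, smul_eq_mul, mul_one] at h2
    omega
  obtain ⟨B, hBX, hBA₁⟩ := hX1
  have hB := (hXm B).1 hBX
  have hBl := hB.2.resolve_left hBA₁
  have hlarge : ∀ A ∈ X, t + 1 ≤ 2 * (privateVerts 𝒜 A).card := by
    intro A hA
    rcases ((hXm A).1 hA).2 with rfl | h
    · exact hBl.trans (Nat.mul_le_mul_left 2 (hmax B hB.1))
    · exact h
  have hX' : X = {A₁, B} := by
    refine Finset.Subset.antisymm (fun C hC => ?_) (Finset.insert_subset hA₁X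
      (Finset.singleton_subset_iff.2 hBX))
    by_contra h
    simp only [Finset.mem_insert, Finset.mem_singleton, not_or] at h
    exact no_three_private hm hmt.le hE₀ hno hA₁ hB.1 ((hXm C).1 hC).1 (Ne.symm hBA₁)
      (Ne.symm h.1) (Ne.symm h.2) (hlarge A₁ hA₁X) hBl (hlarge C hC)
  rw [hX', Finset.sum_pair (Ne.symm hBA₁)] at htotal
  rw [hX'] at hrest
  have hs2 := one_lt_card_inter hm hmt.le hE₀ hno (by nlinarith) h𝒜2 hA₁ hB.1 (Ne.symm hBA₁)
    (hlarge A₁ hA₁X) hBl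
  have hsT := card_inter_add_card_privateVerts_le hA₁ hBA₁
  rw [(hcopy B hB.1).1, Finset.inter_comm] at hsT
  have hun := Finset.card_union_add_card_inter A₁ B
  rw [(hcopy A₁ hA₁).1, (hcopy B hB.1).1] at hun
  have hcs : ∀ C ∈ X, ∀ C' ∈ X, C ≠ C' → (core E C).card + (C ∩ C').card ≤ t + 1 := by
    intro C hC C' hC' hne
    have h1 := ((hXm C).1 hC).1
    have h2 := ((hXm C').1 hC').1
    rw [← (hcopy C h1).1, ← Finset.card_union_of_disjoint]
    · exact Finset.card_le_card (Finset.union_subset (core_subset _ _) Finset.inter_subset_left)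
    · rw [Finset.disjoint_left]
      exact fun v hv hv' => hne (eq_of_mem_core le_rfl (by omega) (hcopy C h1) (hcopy C' h2) hv
        (Finset.mem_inter.1 hv').2)
  have hcA₁ := hcs A₁ hA₁X B hBX (Ne.symm hBA₁)
  have hcB := hcs B hBX A₁ hA₁X hBA₁
  rw [Finset.inter_comm B A₁] at hcB
  have hsub : A₁ ∩ B ⊆ outside E 𝒜 := by
    intro v hv
    rw [Finset.mem_inter] at hv
    refine mem_outside.2 fun C hC hvC => hBA₁ ?_
    rw [← eq_of_mem_core le_rfl (by omega) (hcopy C hC) (hcopy A₁ hA₁) hvC hv.1]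
    exact (eq_of_mem_core le_rfl (by omega) (hcopy C hC) (hcopy B hB.1) hvC hv.2).symm
  set s := (A₁ ∩ B).card with hs
  have h1 := hsum E hE (fun v => 1 + if v ∈ A₁ ∩ B then t - s else 0) fun v hv => by
    split_ifs with h
    · rw [Finset.mem_inter] at h
      have h2 := card_union_le_hdeg_add_one (hcopy A₁ hA₁) (hcopy B hB.1) h.1 h.2
      omega
    · exact hout v hv
  rw [Finset.sum_add_distrib, Finset.sum_const, smul_eq_mul, mul_one, Finset.sum_ite_mem,
    Finset.inter_eq_right.2 hsub, Finset.sum_const, smul_eq_mul, ← hs] at h1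
  obtain ⟨a, ha⟩ := Nat.exists_eq_add_of_le' (by omega : 2 ≤ s)
  obtain ⟨d, hd⟩ := Nat.exists_eq_add_of_le (by omega : s ≤ t)
  have h2 : t - s = d := by omega
  rw [h2] at h1
  have h3 : 2 * d ≤ s * d := Nat.mul_le_mul_right d (by omega)
  have h4 : t + 2 ≤ s * d + 2 * s := by
    rw [ha] at hd ⊢
    rcases Nat.eq_zero_or_pos d with h | h
    · omega
    · nlinarith
  omega

end Graphs

/-- For all integers `k > ℓ ≥ 2` there exists `t₀` such that for every `t ≥ t₀` and every
`n > (1/4)(t+1)² C(t-1, ℓ-2) + 2t`, there exists an extremal `ℓ`-graph on `n` vertices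
for the `(t,k)`-degree condition containing an isolated copy of `K_{t+1}^ℓ`. -/
theorem stmt0 (k ℓ : ℕ) (hkl : ℓ < k) (hl : 2 ≤ ℓ) :
    ∃ t₀ : ℕ, ∀ t : ℕ, t₀ ≤ t → ∀ n : ℕ,
      (((t + 1) ^ 2 * Nat.choose (t - 1) (ℓ - 2) : ℕ) : ℚ) / 4 + 2 * (t : ℚ) < (n : ℚ) →
      ∃ E : Finset (Finset (Fin n)), IsExtremal E ℓ k t ∧
        ∃ A : Finset (Fin n), IsIsolatedCopy E ℓ t A := by
  obtain ⟨r, rfl⟩ := Nat.exists_eq_add_of_le' hl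
  obtain ⟨m, rfl⟩ := Nat.exists_eq_add_of_le' (by omega : 1 ≤ k)
  refine ⟨m + 1, fun t ht n hn => ?_⟩
  rw [Nat.add_sub_cancel] at hn
  have hn' : (t + 1) ^ 2 * (t - 1).choose r + 8 * t < 4 * n := by
    have h : (((t + 1) ^ 2 * (t - 1).choose r + 8 * t : ℕ) : ℚ) < ((4 * n : ℕ) : ℚ) := by
      push_cast at hn ⊢
      linarith
    exact_mod_cast h
  have hcard : t + 1 ≤ Fintype.card (Fin n) := by
    rw [Fintype.card_fin]
    omega
  by_contra! h
  rcases Nat.eq_zero_or_pos r with rfl | hr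
  · have h1 := card_le_of_no_isolated_graph (by omega) (by omega : m < t) hcard h
    rw [Fintype.card_fin] at h1
    rw [Nat.choose_zero_right, mul_one] at hn'
    omega
  · have h1 := card_le_of_no_isolated hr (by omega) (by omega : m < t) hcard h
    rw [Fintype.card_fin] at h1
    omega
end

section
/- Let k > ℓ ≥ 2 and t ≥ k-1 be integers, let n ≥ t+1, and let G be an extremal ℓ-graph on n vertices for the (t,k)-degree condition. Then Σ_{v ∈ V(G)} ( deg_G(v) − C(t, ℓ-1) ) ≤ (1/4)(t+1)²·C(t-1, ℓ-2). -/
open Finset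

open scoped Classical

/-- A vertex of a complete subhypergraph on `t + 1` vertices lies in at least `C(t, k - 1)`
copies of `K_k^ℓ`. -/
lemma choose_le_copiesAt {V : Type*} [Fintype V] {E : Finset (Finset V)} {ℓ k t : ℕ}
    (hk : 1 ≤ k) {v : V} {A : Finset V} (hv : v ∈ A) (hA : A.card = t + 1)
    (hE : A.powersetCard ℓ ⊆ E) : t.choose (k - 1) ≤ copiesAt E ℓ k v := by
  have hcard : ((A.erase v).powersetCard (k - 1)).card = t.choose (k - 1) := by
    rw [card_powersetCard, card_erase_of_mem hv, hA, Nat.add_sub_cancel]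
  rw [← hcard, copiesAt]
  refine card_le_card_of_injOn (insert v) ?_ ?_
  · intro S hS
    obtain ⟨hSA, hSc⟩ := mem_powersetCard.1 (mem_coe.1 hS)
    have hvS : v ∉ S := fun h => notMem_erase v A (hSA h)
    have hins : insert v S ⊆ A := insert_subset hv (hSA.trans (erase_subset v A))
    simp only [coe_filter, mem_univ, true_and, Set.mem_ofPred_eq]
    refine ⟨mem_insert_self v S, ?_, fun e he hec => ?_⟩
    · rw [card_insert_of_notMem hvS]
      omega
    · exact hE (mem_powersetCard.2 ⟨he.trans hins, hec⟩)
  · intro S hS T hT hST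
    have hvS : v ∉ S := fun h => notMem_erase v A ((mem_powersetCard.1 (mem_coe.1 hS)).1 h)
    have hvT : v ∉ T := fun h => notMem_erase v A ((mem_powersetCard.1 (mem_coe.1 hT)).1 h)
    rw [← erase_insert hvS, ← erase_insert hvT]
    exact congrArg (fun U => U.erase v) hST

/-- The handshake identity for `ℓ`-graphs. -/
lemma sum_hdeg {V : Type*} [Fintype V] {E : Finset (Finset V)} {ℓ : ℕ} (hE : IsLGraph ℓ E) :
    ∑ v : V, hdeg E v = E.card * ℓ := by
  simp only [hdeg, card_filter]
  rw [sum_comm, ← smul_eq_mul, ← sum_const]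
  refine sum_congr rfl fun e he => ?_
  rw [← card_filter, filter_univ_mem, hE e he]

/-- A set of `(q + 1) * m + r` vertices can be covered by `q + 2` complete `ℓ`-graphs on `m`
vertices, two of which share `m - r` vertices. -/
lemma exists_cover_by_cliques {V : Type*} (ℓ m r : ℕ) (hr : r ≤ m) (q : ℕ) (W : Finset V)
    (hW : W.card = (q + 1) * m + r) :
    ∃ F : Finset (Finset V), IsLGraph ℓ F ∧
      (∀ v ∈ W, ∃ A : Finset V, v ∈ A ∧ A.card = m ∧ A.powersetCard ℓ ⊆ F) ∧
      F.card + (m - r).choose ℓ ≤ (q + 2) * m.choose ℓ := by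
  induction q generalizing W with
  | zero =>
    obtain ⟨A, hAW, hA⟩ := exists_subset_card_eq (s := W) (n := m) (by omega)
    obtain ⟨C, hCA, hC⟩ := exists_subset_card_eq (s := A) (n := m - r) (by omega)
    have hdisj : Disjoint (W \ A) C := disjoint_sdiff_self_left.mono_right hCA
    have hB : (W \ A ∪ C).card = m := by
      rw [card_union_of_disjoint hdisj, card_sdiff_of_subset hAW]
      omega
    refine ⟨A.powersetCard ℓ ∪ (W \ A ∪ C).powersetCard ℓ, ?_, ?_, ?_⟩
    · intro e he
      rcases mem_union.1 he with h | h <;> exact (mem_powersetCard.1 h).2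
    · intro v hv
      by_cases hvA : v ∈ A
      · exact ⟨A, hvA, hA, subset_union_left⟩
      · exact ⟨W \ A ∪ C, mem_union_left _ (mem_sdiff.2 ⟨hv, hvA⟩), hB, subset_union_right⟩
    · have hle : (m - r).choose ℓ ≤
          (A.powersetCard ℓ ∩ (W \ A ∪ C).powersetCard ℓ).card := by
        rw [← hC, ← card_powersetCard]
        exact card_le_card (subset_inter (powersetCard_mono hCA)
          (powersetCard_mono subset_union_right))
      have hcard := card_union_add_card_inter (A.powersetCard ℓ) ((W \ A ∪ C).powersetCard ℓ)
      rw [card_powersetCard, card_powersetCard, hA, hB] at hcard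
      omega
  | succ q ih =>
    have hm : (q + 1 + 1) * m = (q + 1) * m + m := by ring
    obtain ⟨A, hAW, hA⟩ := exists_subset_card_eq (s := W) (n := m) (by omega)
    obtain ⟨F, hF, hcov, hcard⟩ := ih (W \ A) (by rw [card_sdiff_of_subset hAW]; omega)
    refine ⟨F ∪ A.powersetCard ℓ, ?_, ?_, ?_⟩
    · intro e he
      rcases mem_union.1 he with h | h
      · exact hF e h
      · exact (mem_powersetCard.1 h).2
    · intro v hv
      by_cases hvA : v ∈ A
      · exact ⟨A, hvA, hA, subset_union_right⟩
      · obtain ⟨B, hvB, hB, hBF⟩ := hcov v (mem_sdiff.2 ⟨hv, hvA⟩)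
        exact ⟨B, hvB, hB, hBF.trans subset_union_left⟩
    · have hle := card_union_le F (A.powersetCard ℓ)
      rw [card_powersetCard, hA] at hle
      have hmul : (q + 1 + 2) * m.choose ℓ = (q + 2) * m.choose ℓ + m.choose ℓ := by ring
      omega

lemma choose_le_choose_sub_add_mul (t a r : ℕ) (hr : r ≤ t) :
    t.choose (a + 1) ≤ (t - r).choose (a + 1) + r * (t - 1).choose a := by
  induction r with
  | zero => simp
  | succ r ih =>
    have hpascal : (t - r).choose (a + 1) =
        (t - (r + 1)).choose a + (t - (r + 1)).choose (a + 1) := by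
      rw [show t - r = (t - (r + 1)) + 1 by omega, Nat.choose_succ_succ]
    have hmono : (t - (r + 1)).choose a ≤ (t - 1).choose a :=
      Nat.choose_le_choose a (by omega)
    have := ih (by omega)
    rw [add_mul, one_mul]
    omega

/-- For an extremal `ℓ`-graph `G` on `n ≥ t+1` vertices for the `(t,k)`-degree condition,
the total excess degree sum is at most `(1/4)(t+1)² C(t-1, ℓ-2)`. -/
theorem stmt1 (k ℓ t : ℕ) (hkl : ℓ < k) (hl : 2 ≤ ℓ) (ht : k - 1 ≤ t)
    (V : Type*) [DecidableEq V] [Fintype V] (hn : t + 1 ≤ Fintype.card V)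
    (E : Finset (Finset V)) (hE : IsExtremal E ℓ k t) :
    ∑ v : V, ((hdeg E v : ℚ) - (Nat.choose t (ℓ - 1) : ℚ)) ≤
      (((t + 1) ^ 2 * Nat.choose (t - 1) (ℓ - 2) : ℕ) : ℚ) / 4 := by
  obtain ⟨hL, -, hmin⟩ := hE
  obtain ⟨a, rfl⟩ : ∃ a, ℓ = a + 2 := ⟨ℓ - 2, by omega⟩
  set n := Fintype.card V with hn_def
  obtain ⟨q, r, hr, hnq⟩ : ∃ q r, r ≤ t ∧ n = (q + 1) * (t + 1) + r := by
    obtain ⟨q, hq⟩ : ∃ q, n / (t + 1) = q + 1 :=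
      Nat.exists_eq_succ_of_ne_zero (Nat.div_pos hn t.succ_pos).ne'
    refine ⟨q, n % (t + 1), Nat.lt_succ_iff.1 (Nat.mod_lt n t.succ_pos), ?_⟩
    rw [← hq, mul_comm]
    exact (Nat.div_add_mod n (t + 1)).symm
  obtain ⟨F, hF, hcov, hcard⟩ :=
    exists_cover_by_cliques (a + 2) (t + 1) r (by omega) q (univ : Finset V) (by
      rw [card_univ]; exact hnq)
  have hEF : E.card ≤ F.card := hmin F hF fun v => by
    obtain ⟨A, hvA, hA, hAF⟩ := hcov v (mem_univ v)
    exact choose_le_copiesAt (by omega) hvA hA hAF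
  obtain ⟨s, rfl⟩ : ∃ s, t = s + r := ⟨t - r, by omega⟩
  set c := (s + r - 1).choose a
  set x := (s + r).choose (a + 1)
  set y := s.choose (a + 1)
  have hchoose := choose_le_choose_sub_add_mul (s + r) a r hr
  rw [Nat.add_sub_cancel] at hchoose
  rw [show s + r + 1 - r = s + 1 by omega] at hcard
  rw [sum_sub_distrib, ← Nat.cast_sum, sum_hdeg hL, sum_const, card_univ, ← hn_def, nsmul_eq_mul,
    hnq, show a + 2 - 1 = a + 1 from rfl, Nat.add_sub_cancel]
  have hX : (s + r + 1).choose (a + 2) * (a + 2) = (s + r + 1) * x :=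
    (Nat.add_one_mul_choose_eq (s + r) (a + 1)).symm
  have hY : (s + 1).choose (a + 2) * (a + 2) = (s + 1) * y :=
    (Nat.add_one_mul_choose_eq s (a + 1)).symm
  have hE_le : E.card * (a + 2) + (s + 1) * y ≤ (q + 2) * ((s + r + 1) * x) := by
    rw [← hX, ← hY, ← add_mul, ← mul_assoc]
    exact Nat.mul_le_mul_right _ (by omega)
  have hE_le' : (E.card * (a + 2) + (s + 1) * y : ℚ) ≤ (q + 2) * ((s + r + 1) * x) :=
    mod_cast hE_le
  have hxy : ((s + 1) * x : ℚ) ≤ (s + 1) * (y + r * c) :=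
    mod_cast Nat.mul_le_mul_left (s + 1) hchoose
  have hsq : 0 ≤ ((s + 1 - r : ℚ)) ^ 2 * c := by positivity
  push_cast
  nlinarith
end

section
/- Let k > ℓ ≥ 2 and t ≥ k-1 be integers, and let G be an ℓ-graph in which every vertex is contained in at least C(t, k-1) copies of K_k^ℓ. Then every vertex v of G satisfies deg_G(v) ≥ C(t, ℓ-1). -/
open Finset

open scoped Classical

/-- If every vertex of an `ℓ`-graph is contained in at least `C(t,k-1)` copies of `K_k^ℓ`,
then every vertex has degree at least `C(t, ℓ-1)`. -/
theorem stmt2 (k ℓ t : ℕ) (hkl : ℓ < k) (hl : 2 ≤ ℓ) (ht : k - 1 ≤ t)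
    (V : Type*) [DecidableEq V] [Fintype V]
    (E : Finset (Finset V)) (hE : IsLGraph ℓ E) (hdc : DegCond E ℓ k t) :
    ∀ v : V, Nat.choose t (ℓ - 1) ≤ hdeg E v := by
  intro v
  let f : V ↪ Fin (Fintype.card V + t) :=
    (Fintype.equivFin V).toEmbedding.trans (Fin.castAddEmb t)
  let link : Finset V → Finset (Fin (Fintype.card V + t)) := fun S => (S.erase v).map f
  have link_inj {S T : Finset V} (hS : v ∈ S) (hT : v ∈ T) (h : link S = link T) : S = T := by
    have h' : S.erase v = T.erase v := Finset.map_injective f h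
    rw [← insert_erase hS, h', insert_erase hT]
  let copies : Finset (Finset V) := univ.filter fun S => v ∈ S ∧ IsCopy E ℓ k S
  have mem_copies {S : Finset V} : S ∈ copies ↔ v ∈ S ∧ IsCopy E ℓ k S := by simp [copies]
  let 𝒜 := copies.image link
  have hsized : (𝒜 : Set (Finset (Fin (Fintype.card V + t)))).Sized (k - 1) := by
    intro B hB
    obtain ⟨S, hS, rfl⟩ := mem_image.1 (mem_coe.1 hB)
    obtain ⟨hvS, hcard, -⟩ := mem_copies.1 hS
    rw [card_map, card_erase_of_mem hvS, hcard]
  have hcard : t.choose (k - 1) ≤ #𝒜 := by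
    rw [card_image_of_injOn fun S hS T hT h =>
      link_inj (mem_copies.1 hS).1 (mem_copies.1 hT).1 h]
    refine (hdc v).trans_eq ?_
    unfold copiesAt
    congr!
  have hkk := kruskal_katona_lovasz_form (i := k - ℓ) (by lia) ht (by lia) hsized hcard
  rw [show k - 1 - (k - ℓ) = ℓ - 1 by lia] at hkk
  have hsub : shadow^[k - ℓ] 𝒜 ⊆ (E.filter fun e => v ∈ e).image link := by
    intro B hB
    obtain ⟨A, hA, hBA, hAB⟩ := mem_shadow_iterate_iff_exists_mem_card_add.1 hB
    have hAcard : #A = k - 1 := hsized hA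
    obtain ⟨S, hS, rfl⟩ := mem_image.1 hA
    obtain ⟨hvS, -, hcopy⟩ := mem_copies.1 hS
    obtain ⟨T, hTS, rfl⟩ := subset_map_iff.1 hBA
    have hvT : v ∉ T := fun h => notMem_erase v S (hTS h)
    refine mem_image.2 ⟨insert v T, mem_filter.2 ⟨hcopy _ ?_ ?_, mem_insert_self v T⟩, ?_⟩
    · exact insert_subset hvS (hTS.trans (erase_subset v S))
    · rw [card_insert_of_notMem hvT]
      rw [hAcard, card_map] at hAB
      lia
    · simp only [link, erase_insert hvT]
  calc t.choose (ℓ - 1) ≤ #(shadow^[k - ℓ] 𝒜) := hkk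
    _ ≤ #((E.filter fun e => v ∈ e).image link) := card_le_card hsub
    _ ≤ #(E.filter fun e => v ∈ e) := card_image_le
    _ = hdeg E v := by unfold hdeg; congr!
end

section
/- Let H₀ be an ℓ-uniform hypergraph on vertex set {1,…,n}, let k ≥ ℓ, let 1 ≤ i < j ≤ n, and let u be any vertex with u ≠ j. Then the number of copies of K_k^ℓ in S_{i,j}(H₀) that contain u is at least the number of copies of K_k^ℓ in H₀ that contain u. -/
open Finset

open scoped Classical

/-- The shifting operator `S_{i,j}` applied to a single edge. -/
def shiftEdge {n : ℕ} (E : Finset (Finset (Fin n))) (i j : Fin n)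
    (e : Finset (Fin n)) : Finset (Fin n) :=
  if j ∈ e ∧ i ∉ e ∧ insert i (e.erase j) ∉ E then insert i (e.erase j) else e

/-- The shifted hypergraph `S_{i,j}(H₀)`. -/
noncomputable def shiftGraph {n : ℕ} (E : Finset (Finset (Fin n))) (i j : Fin n) :
    Finset (Finset (Fin n)) :=
  E.image (shiftEdge E i j)

theorem shiftEdge_of_mem {n : ℕ} {E : Finset (Finset (Fin n))} {i j : Fin n}
    {e : Finset (Fin n)} (h : j ∈ e → i ∉ e → insert i (e.erase j) ∈ E) :
    shiftEdge E i j e = e :=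
  if_neg fun ⟨hj, hi, hE⟩ => hE (h hj hi)

theorem mem_shiftGraph_of_mem {n : ℕ} {E : Finset (Finset (Fin n))} {i j : Fin n}
    {e : Finset (Fin n)} (he : e ∈ E) (h : j ∈ e → i ∉ e → insert i (e.erase j) ∈ E) :
    e ∈ shiftGraph E i j :=
  mem_image.2 ⟨e, he, shiftEdge_of_mem h⟩

theorem mem_shiftGraph_of_swap_mem {n : ℕ} {E : Finset (Finset (Fin n))} {i j : Fin n}
    {e : Finset (Fin n)} (hij : i ≠ j) (hi : i ∈ e) (hj : j ∉ e)
    (he : insert j (e.erase i) ∈ E) : e ∈ shiftGraph E i j := by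
  by_cases heE : e ∈ E
  · exact mem_shiftGraph_of_mem heE fun h => absurd h hj
  · have hswap : insert i ((insert j (e.erase i)).erase j) = e := by
      rw [erase_insert (by simp [hj]), insert_erase hi]
    refine mem_image.2 ⟨_, he, ?_⟩
    rw [shiftEdge, if_pos, hswap]
    exact ⟨by simp, by simp [hij], by rwa [hswap]⟩

theorem card_insert_erase_of_mem_of_notMem {α : Type*} [DecidableEq α] {i j : α} {s : Finset α}
    (hj : j ∈ s) (hi : i ∉ s) : (insert i (s.erase j)).card = s.card := by
  rw [card_insert_of_notMem (by simp [hi]), card_erase_add_one hj]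

theorem shiftEdge_injOn {n : ℕ} (E : Finset (Finset (Fin n))) (i j : Fin n) :
    Set.InjOn (shiftEdge E i j) E := by
  intro a ha b hb hab
  simp only [shiftEdge] at hab
  split_ifs at hab with h₁ h₂ h₂
  · have ha' : ((insert i (a.erase j)).erase i) = a.erase j := erase_insert (by simp [h₁.2.1])
    have hb' : ((insert i (b.erase j)).erase i) = b.erase j := erase_insert (by simp [h₂.2.1])
    rw [← insert_erase h₁.1, ← insert_erase h₂.1, ← ha', ← hb', hab]
  · exact absurd (hab ▸ hb) h₁.2.2
  · exact absurd (hab ▸ ha) h₂.2.2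
  · exact hab

/-- A copy of `K_k^ℓ` remains a copy if all its exchanges of `j` for `i` are edges. -/
theorem IsCopy.shiftGraph_self {n ℓ k : ℕ} {E : Finset (Finset (Fin n))} {i j : Fin n}
    {S : Finset (Fin n)} (hS : IsCopy E ℓ k S)
    (h : ∀ e ⊆ S, e.card = ℓ → j ∈ e → i ∉ e → insert i (e.erase j) ∈ E) :
    IsCopy (shiftGraph E i j) ℓ k S :=
  ⟨hS.1, fun e heS he => mem_shiftGraph_of_mem (hS.2 e heS he) (h e heS he)⟩

/-- Exchanging `j` for `i` in a copy of `K_k^ℓ` gives a copy in the shifted hypergraph. -/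
theorem IsCopy.shiftGraph_swap {n ℓ k : ℕ} {E : Finset (Finset (Fin n))} {i j : Fin n}
    {S : Finset (Fin n)} (hS : IsCopy E ℓ k S) (hij : i ≠ j) (hj : j ∈ S) (hi : i ∉ S) :
    IsCopy (shiftGraph E i j) ℓ k (insert i (S.erase j)) := by
  refine ⟨(card_insert_erase_of_mem_of_notMem hj hi).trans hS.1, fun e heS he => ?_⟩
  have hje : j ∉ e := fun h => by simpa [hij.symm] using heS h
  by_cases hie : i ∈ e
  · refine mem_shiftGraph_of_swap_mem hij hie hje (hS.2 _ ?_ ?_)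
    · grind
    · rw [card_insert_erase_of_mem_of_notMem hie hje, he]
  · refine mem_shiftGraph_of_mem (hS.2 e ?_ he) fun h => absurd h hje
    grind

theorem isCopy_shiftGraph_shiftEdge {n ℓ k : ℕ} {E C : Finset (Finset (Fin n))} {i j : Fin n}
    (hij : i ≠ j) (hC : ∀ T ∈ C, IsCopy E ℓ k T) {S : Finset (Fin n)} (hS : S ∈ C) :
    IsCopy (shiftGraph E i j) ℓ k (shiftEdge C i j S) := by
  rw [shiftEdge]
  split_ifs with h
  · exact (hC S hS).shiftGraph_swap hij h.1 h.2.1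
  · refine (hC S hS).shiftGraph_self fun e heS he hje hie => ?_
    have hcard := (card_insert_erase_of_mem_of_notMem hje hie).trans he
    by_cases hi : i ∈ S
    · exact (hC S hS).2 _ (insert_subset hi ((erase_subset _ _).trans heS)) hcard
    · have hT : insert i (S.erase j) ∈ C := by
        by_contra hT
        exact h ⟨heS hje, hi, hT⟩
      exact (hC _ hT).2 _ (insert_subset_insert _ (erase_subset_erase _ heS)) hcard

theorem mem_shiftEdge_of_ne {n : ℕ} {E : Finset (Finset (Fin n))} {i j u : Fin n}
    {e : Finset (Fin n)} (hu : u ≠ j) (he : u ∈ e) : u ∈ shiftEdge E i j e := by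
  rw [shiftEdge]
  split_ifs
  · exact mem_insert_of_mem (mem_erase.2 ⟨hu, he⟩)
  · exact he

/-- Shifting does not decrease the number of copies of `K_k^ℓ` containing a fixed
vertex `u ≠ j`. -/
theorem stmt9 (n ℓ k : ℕ) (hlk : ℓ ≤ k)
    (E : Finset (Finset (Fin n))) (hE : IsLGraph ℓ E)
    (i j : Fin n) (hij : i < j) (u : Fin n) (hu : u ≠ j) :
    copiesAt E ℓ k u ≤ copiesAt (shiftGraph E i j) ℓ k u := by
  refine card_le_card_of_injOn _ (fun S hS => ?_) (shiftEdge_injOn _ i j)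
  have hS' := ((@mem_filter _ _ (_) _ _).1 (mem_coe.1 hS)).2
  exact mem_coe.2 ((@mem_filter _ _ (_) _ _).2 ⟨mem_univ _, mem_shiftEdge_of_ne hu hS'.1,
    isCopy_shiftGraph_shiftEdge hij.ne (fun T hT => ((@mem_filter _ _ (_) _ _).1 hT).2.2) (mem_coe.1 hS)⟩)
end
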